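/- arXiv:1205.5090 — 2 statements merged into one kernel-verified Lean document; each statement's English description precedes it below -/
import Mathlib

section
/- Let G be a free group of finite rank r > 1 with free generating set S, acting on a standard Borel probability space (X, μ) by μ-preserving Borel automorphisms, let α be a generating partition with H(α) < ∞, and let Σ be a G-invariant sub-σ-algebra. Let π : X → Y be a Borel map to a standard Borel probability space (Y, ν) with π_*μ = ν such that Σ equals the σ-algebra {π⁻¹(B) : B ⊆ Y Borel} up to μ-null sets, and let {μ_y : y ∈ Y} be a disintegration of μ over ν: each μ_y is a Borel probability measure on X, y ↦ μ_y(B) is measurable for each Borel B, μ_y(π⁻¹(y)) = 1 for ν-a.e. y, and μ(B) = ∫ μ_y(B) dν(y) for all Borel B. If f_G(X, μ/Σ) = lim_{n→∞} F_G(X, μ/Σ, S, B_n·α) ≠ −∞ and ν({y ∈ Y : μ_y is not purely atomic}) > 0, then lim_{n→∞} (H(B_{n+1}·α / B_n·α ∨ Σ))^{1/n} = 2r − 1. -/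
open MeasureTheory Filter Set
open scoped ENNReal symmDiff Pointwise

namespace FPaper

/-- The free group of rank `r`; its free generating set `S` is `{FreeGroup.of i | i : Fin r}`. -/
abbrev FG (r : ℕ) := FreeGroup (Fin r)

/-- The reduced `S`-word length of a group element. -/
def wlen {r : ℕ} (g : FG r) : ℕ := g.toWord.length

/-- The ball of radius `n` in `FG r` with respect to the word length. -/
def ball (r n : ℕ) : Set (FG r) := {g | wlen g ≤ n}

instance ballFinite (r n : ℕ) : Finite (ball r n) := by
  have h : ball r n ⊆ FreeGroup.mk '' {l : List (Fin r × Bool) | l.length ≤ n} :=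
    fun g hg => ⟨g.toWord, hg, FreeGroup.mk_toWord⟩
  exact (((List.finite_length_le _ n).image _).subset h).to_subtype

/-- An action of a group `G` on a measurable space `X` by Borel automorphisms. -/
structure BorelAction (G : Type*) [Group G] (X : Type*) [MeasurableSpace X] where
  act : G → X → X
  act_one : ∀ x, act 1 x = x
  act_mul : ∀ g h x, act (g * h) x = act g (act h x)
  measurable_act : ∀ g, Measurable (act g)

namespace BorelAction

variable {G X : Type*} [Group G] [mX : MeasurableSpace X]

/-- The action preserves the measure `μ`. -/
def Preserves (T : BorelAction G X) (μ : Measure X) : Prop :=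
  ∀ g : G, MeasurePreserving (T.act g) μ μ

/-- The translated set `g · B`. -/
def smulSet (T : BorelAction G X) (g : G) (B : Set X) : Set X := T.act g⁻¹ ⁻¹' B

/-- The translated partition `g · α`, where a countable measurable partition is recorded
by a (measurable, countably-valued) function whose fibers are the cells. -/
def tr {I : Type*} (T : BorelAction G X) (g : G) (a : X → I) : X → I :=
  fun x => a (T.act g⁻¹ x)

/-- The join `F · α = ⋁_{f ∈ F} f · α` of the translates of a partition over a set `F ⊆ G`. -/
def joinF {I : Type*} (T : BorelAction G X) (F : Set G) (a : X → I) : X → (F → I) :=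
  fun x f => a (T.act (f : G)⁻¹ x)

/-- The σ-algebra generated by the partitions `f · α`, `f ∈ F`. -/
def partSA {I : Type*} (T : BorelAction G X) (F : Set G) (a : X → I) : MeasurableSpace X :=
  ⨆ f ∈ F, MeasurableSpace.comap (T.tr f a) ⊤

/-- The partition `a` is generating: the smallest `G`-invariant σ-algebra containing `a`
(i.e. the one generated by all translates of `a`) contains every measurable set up to
`ν`-null sets. -/
def Generating {I : Type*} (T : BorelAction G X) (a : X → I) (ν : Measure X) : Prop :=
  ∀ B : Set X, MeasurableSet B →
    ∃ B', MeasurableSet[T.partSA Set.univ a] B' ∧ ν (B ∆ B') = 0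


/-- Ergodicity of the action with respect to `ν`. -/
def IsErgodic (T : BorelAction G X) (ν : Measure X) : Prop :=
  ∀ B : Set X, MeasurableSet B → (∀ g : G, ν (T.smulSet g B ∆ B) = 0) → ν B = 0 ∨ ν B = 1

/-- The action is essentially free with respect to `ν`. -/
def EssentiallyFree (T : BorelAction G X) (ν : Measure X) : Prop :=
  ν {x | ∀ g : G, g ≠ 1 → T.act g x ≠ x} = 1

/-- The stabilizer subgroup of a point. -/
def stab (T : BorelAction G X) (y : X) : Subgroup G where
  carrier := {g | T.act g y = y}
  one_mem' := T.act_one y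
  mul_mem' := by
    intro g h hg hh
    simp only [Set.mem_setOf_eq] at *
    rw [T.act_mul, hh, hg]
  inv_mem' := by
    intro g hg
    simp only [Set.mem_setOf_eq] at *
    conv_lhs => rw [← hg]
    rw [← T.act_mul, inv_mul_cancel, T.act_one]

end BorelAction

/-- `m` is a `G`-invariant sub-σ-algebra. -/
def InvariantSA {G X : Type*} [Group G] (m : MeasurableSpace X) [mX : MeasurableSpace X]
    (T : BorelAction G X) : Prop :=
  m ≤ mX ∧ ∀ (g : G) (B : Set X), MeasurableSet[m] B → MeasurableSet[m] (T.act g ⁻¹' B)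

/-- A measure is purely atomic: the set of atoms has full measure. -/
def PurelyAtomic {X : Type*} [MeasurableSpace X] (ν : Measure X) : Prop :=
  ν {x | 0 < ν {x}} = 1

/-- Shannon entropy of a countable measurable partition (recorded as a countably-valued
function), with values in `[0, ∞]`. -/
noncomputable def Hpart {X I : Type*} [MeasurableSpace X] [Countable I]
    (μ : Measure X) (a : X → I) : ℝ≥0∞ :=
  ∑' i : I, ENNReal.ofReal (Real.negMulLog (μ (a ⁻¹' {i})).toReal)

/-- Conditional Shannon entropy of a countable partition given a sub-σ-algebra `m`:
`H(α/m) = ∫ ∑_{A ∈ α} φ(E[1_A | m](x)) dμ(x)` with `φ(t) = -t log t`. -/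
noncomputable def condEntS {X I : Type*} (m : MeasurableSpace X) [mX : MeasurableSpace X]
    [Countable I] (μ : Measure X) (a : X → I) : ℝ≥0∞ :=
  ∫⁻ x, ∑' i : I,
    ENNReal.ofReal (Real.negMulLog ((μ[(a ⁻¹' {i}).indicator (fun _ => (1:ℝ)) | m]) x)) ∂μ

/-- Conditional Shannon entropy of a partition given another partition:
`H(α/β) = ∑_{B ∈ β} ∑_{A ∈ α} -μ(B) · (μ(A∩B)/μ(B)) · log (μ(A∩B)/μ(B))`
(equivalently `H(α ∨ β) − H(β)`), with values in `[0, ∞]`. -/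
noncomputable def condEntP {X I J : Type*} [MeasurableSpace X] [Countable I] [Countable J]
    (μ : Measure X) (a : X → I) (b : X → J) : ℝ≥0∞ :=
  ∑' q : I × J, μ (b ⁻¹' {q.2}) *
    ENNReal.ofReal (Real.negMulLog
      ((μ (a ⁻¹' {q.1} ∩ b ⁻¹' {q.2})).toReal / (μ (b ⁻¹' {q.2})).toReal))

/-- `F_G(X, μ, S, β) = (1-2r)·H(β) + ∑_{s ∈ S} H(s·β ∨ β)`. -/
noncomputable def FF {r : ℕ} {X I : Type*} [MeasurableSpace X] [Countable I]
    (μ : Measure X) (T : BorelAction (FG r) X) (b : X → I) : ℝ :=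
  (1 - 2 * (r : ℝ)) * (Hpart μ b).toReal
    + ∑ i : Fin r, (Hpart μ (fun x => (T.tr (FreeGroup.of i) b x, b x))).toReal

/-- The sequence `n ↦ F_G(X, μ, S, B_n · α)`. -/
noncomputable def fSeq {r : ℕ} {X : Type*} [MeasurableSpace X]
    (μ : Measure X) (T : BorelAction (FG r) X) (a : X → ℕ) (n : ℕ) : ℝ :=
  FF μ T (T.joinF (ball r n) a)

/-- The f-invariant entropy `f_G(X, μ) = lim_n F_G(X, μ, S, B_n·α)`, the limit (= infimum,
since the sequence is non-increasing) of the sequence `fSeq`, with values in `[-∞, ∞)`. -/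
noncomputable def fInv {r : ℕ} {X : Type*} [MeasurableSpace X]
    (μ : Measure X) (T : BorelAction (FG r) X) (a : X → ℕ) : EReal :=
  ⨅ n : ℕ, ((fSeq μ T a n : ℝ) : EReal)

/-- Relative version `F_G(X, μ/Σ, S, β) = (1-2r)·H(β/Σ) + ∑_{s ∈ S} H(s·β ∨ β / Σ)`. -/
noncomputable def FFrel {r : ℕ} {X I : Type*} (m : MeasurableSpace X) [mX : MeasurableSpace X]
    [Countable I] (μ : Measure X) (T : BorelAction (FG r) X) (b : X → I) : ℝ :=
  (1 - 2 * (r : ℝ)) * (condEntS m μ b).toReal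
    + ∑ i : Fin r, (condEntS m μ (fun x => (T.tr (FreeGroup.of i) b x, b x))).toReal

/-- The sequence `n ↦ F_G(X, μ/Σ, S, B_n · α)`. -/
noncomputable def fSeqRel {r : ℕ} {X : Type*} (m : MeasurableSpace X) [mX : MeasurableSpace X]
    (μ : Measure X) (T : BorelAction (FG r) X) (a : X → ℕ) (n : ℕ) : ℝ :=
  FFrel m μ T (T.joinF (ball r n) a)

/-- The relative f-invariant entropy `f_G(X, μ/Σ)`, with values in `[-∞, ∞)`. -/
noncomputable def fInvRel {r : ℕ} {X : Type*} (m : MeasurableSpace X) [mX : MeasurableSpace X]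
    (μ : Measure X) (T : BorelAction (FG r) X) (a : X → ℕ) : EReal :=
  ⨅ n : ℕ, ((fSeqRel m μ T a n : ℝ) : EReal)

/-- A total order on `S ∪ S⁻¹` is recorded by an injection `ord : Fin r × Bool → ℕ`;
`g ≺ h` iff `|g| < |h|`, or `|g| = |h|` and the reduced word of `g` lexicographically
precedes that of `h`. -/
def wlt {r : ℕ} (ord : Fin r × Bool → ℕ) (g h : FG r) : Prop :=
  wlen g < wlen h ∨ (wlen g = wlen h ∧ List.Lex (fun p q => ord p < ord q) g.toWord h.toWord)

/-- `Pre(g)`: the set of elements strictly preceding `g`. -/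
def Pre {r : ℕ} (ord : Fin r × Bool → ℕ) (g : FG r) : Set (FG r) := {h | wlt ord h g}

/-- The generator or inverse generator corresponding to a letter. -/
def letter {r : ℕ} (p : Fin r × Bool) : FG r :=
  if p.2 then FreeGroup.of p.1 else (FreeGroup.of p.1)⁻¹

/-- The first (leftmost) letter of the reduced word of `g` (junk value `1` for `g = 1`). -/
def firstLetter {r : ℕ} (g : FG r) : FG r := ((g.toWord.head?).map letter).getD 1

/-- The independence decay `δ(g, α/Σ)`, as a real number:
`δ(g, α/Σ) = H(s⁻¹g·α / Pre(s⁻¹g)·α ∨ Σ) − H(g·α / Pre(g)·α ∨ Σ)` where `s` is the first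
letter of `g`. -/
noncomputable def idecay {r : ℕ} {X I : Type*} (m : MeasurableSpace X) [mX : MeasurableSpace X]
    [Countable I] (μ : Measure X) (T : BorelAction (FG r) X)
    (ord : Fin r × Bool → ℕ) (a : X → I) (g : FG r) : ℝ :=
  (condEntS (m ⊔ T.partSA (Pre ord ((firstLetter g)⁻¹ * g)) a) μ
      (T.tr ((firstLetter g)⁻¹ * g) a)).toReal
  - (condEntS (m ⊔ T.partSA (Pre ord g) a) μ (T.tr g a)).toReal

/-- The entropy `H(τ)` of a probability space: the supremum of the Shannon entropies of
finite measurable partitions. -/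
noncomputable def measEnt {M : Type*} [MeasurableSpace M] (τ : Measure M) : ℝ≥0∞ :=
  ⨆ (P : Finset (Set M)) (_ : ∀ p ∈ P, MeasurableSet p)
    (_ : (P : Set (Set M)).PairwiseDisjoint id) (_ : ⋃₀ (P : Set (Set M)) = Set.univ),
    ∑ p ∈ P, ENNReal.ofReal (Real.negMulLog (τ p).toReal)

/-- The non-negative part of an extended real, in `ℝ≥0∞`. -/
noncomputable def erealToENNReal (x : EReal) : ℝ≥0∞ :=
  if x = ⊤ then ⊤ else ENNReal.ofReal x.toReal

/-- The integral of an `EReal`-valued function (positive part minus negative part),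
with values in `[-∞, ∞]`. -/
noncomputable def eIntegral {M : Type*} [MeasurableSpace M] (τ : Measure M) (f : M → EReal) :
    EReal :=
  ((∫⁻ m, erealToENNReal (f m) ∂τ : ℝ≥0∞) : EReal)
    - ((∫⁻ m, erealToENNReal (-(f m)) ∂τ : ℝ≥0∞) : EReal)

/-- The set of `G`-invariant Borel probability measures on `X`. -/
def InvProb {G X : Type*} [Group G] [MeasurableSpace X] (T : BorelAction G X) :
    Set (Measure X) :=
  {ν | IsProbabilityMeasure ν ∧ ∀ g : G, MeasurePreserving (T.act g) ν ν}

section CondEntropy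

variable {X : Type*} {m m' : MeasurableSpace X} [mX : MeasurableSpace X] {μ : Measure X}

/-- Conditional entropy only depends on the partition, not on its labels. -/
theorem condEntS_injective_comp {I J : Type*} [Countable I] [Countable J] {e : I → J}
    (he : Function.Injective e) (b : X → I) :
    condEntS m μ (e ∘ b) = condEntS m μ b := by
  refine lintegral_congr fun x => ?_
  rw [← he.tsum_eq]
  · refine tsum_congr fun i => ?_
    rw [preimage_comp, ← image_singleton, preimage_image_eq _ he]
  · intro j hj
    by_contra hn
    apply hj
    have : (e ∘ b) ⁻¹' {j} = ∅ := by
      ext y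
      simp only [mem_preimage, Function.comp_apply, mem_singleton_iff, mem_empty_iff_false,
        iff_false]
      exact fun h => hn ⟨b y, h⟩
    simp only [this, indicator_empty]
    have h0 : μ[(fun _ => (0 : ℝ)) | m] = 0 := condExp_zero
    simp [h0]

/-- Conditional entropy is the average entropy of the conditional measures. -/
theorem condEntS_eq_lintegral_Hpart {I : Type*} [Countable I] {κ : X → Measure X}
    (b : X → I)
    (hκ : ∀ i, (fun x => (κ x (b ⁻¹' {i})).toReal) =ᵐ[μ]
      μ[(b ⁻¹' {i}).indicator (fun _ => (1 : ℝ)) | m]) :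
    condEntS m μ b = ∫⁻ x, Hpart (κ x) b ∂μ := by
  refine lintegral_congr_ae ?_
  filter_upwards [ae_all_iff.2 hκ] with x hx
  simp only [Hpart, hx]

theorem aemeasurable_negMulLog_condExp_indicator (B : Set X) : AEMeasurable (fun x =>
    ENNReal.ofReal (Real.negMulLog ((μ[B.indicator (fun _ => (1 : ℝ)) | m]) x))) μ :=
  (Real.continuous_negMulLog.measurable.comp_aemeasurable
    integrable_condExp.aestronglyMeasurable.aemeasurable).ennreal_ofReal

variable [IsProbabilityMeasure μ]

/-- A function with the correct integrals over `m`-measurable sets is a version of the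
conditional probability of `B`. -/
theorem toReal_ae_eq_condExp_indicator (hm : m ≤ mX) {B : Set X} (hB : MeasurableSet B)
    {f : X → ℝ≥0∞} (hf : Measurable[m] f)
    (h : ∀ A, MeasurableSet[m] A → ∫⁻ x in A, f x ∂μ = μ (A ∩ B)) :
    (fun x => (f x).toReal) =ᵐ[μ] μ[B.indicator (fun _ => (1 : ℝ)) | m] := by
  have hfX : Measurable f := hf.mono hm le_rfl
  have htot : ∫⁻ x, f x ∂μ ≠ ∞ := by
    have := h univ MeasurableSet.univ
    rw [setLIntegral_univ] at this
    rw [this]; exact measure_ne_top _ _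
  have h_integral : Integrable (fun x => (f x).toReal) μ :=
    integrable_toReal_of_lintegral_ne_top hfX.aemeasurable htot
  refine ae_eq_condExp_of_forall_setIntegral_eq hm
    ((integrable_const (1 : ℝ)).indicator hB) (fun s _ _ => h_integral.integrableOn) ?_
    (hf.ennreal_toReal.stronglyMeasurable.aestronglyMeasurable)
  intro s hs _
  rw [integral_toReal hfX.aemeasurable.restrict
    (ae_restrict_of_ae (ae_lt_top hfX htot)), h s hs,
    setIntegral_indicator hB]
  simp [measureReal_def]

theorem setLIntegral_condExpKernel [StandardBorelSpace X] (hm : m ≤ mX) {A B : Set X}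
    (hA : MeasurableSet[m] A) (hB : MeasurableSet B) :
    ∫⁻ x in A, ProbabilityTheory.condExpKernel μ m x B ∂μ = μ (A ∩ B) := by
  have h := congrArg (fun ρ => ρ (A ×ˢ B))
    (ProbabilityTheory.compProd_trim_condExpKernel (μ := μ) hm)
  rw [Measure.compProd_apply_prod hA hB,
    setLIntegral_trim hm (ProbabilityTheory.measurable_condExpKernel hB) hA] at h
  rw [h, Measure.map_apply (hf := ?_) (hs := hA.prod hB)]
  · rfl
  · exact (measurable_id'' hm).prodMk measurable_id

theorem setLIntegral_eq_lintegral_condExpKernel_mul [StandardBorelSpace X] (hm : m ≤ mX)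
    {C : Set X} (hC : MeasurableSet C) {g : X → ℝ≥0∞} (hg : Measurable[m] g) :
    ∫⁻ x in C, g x ∂μ = ∫⁻ x, ProbabilityTheory.condExpKernel μ m x C * g x ∂μ := by
  have hκ := ProbabilityTheory.measurable_condExpKernel (μ := μ) (m := m) hC
  have h : (μ.restrict C).trim hm =
      (μ.trim hm).withDensity fun x => ProbabilityTheory.condExpKernel μ m x C := by
    refine @Measure.ext _ m _ _ fun A hA => ?_
    rw [trim_measurableSet_eq hm hA, withDensity_apply _ hA, setLIntegral_trim hm hκ hA,
      setLIntegral_condExpKernel hm hA hC, Measure.restrict_apply (hm _ hA)]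
  rw [← lintegral_trim hm hg, h, lintegral_withDensity_eq_lintegral_mul _ hκ hg,
    lintegral_trim hm (hκ.mul hg)]
  rfl

theorem condEntS_eq_lintegral_condExpKernel [StandardBorelSpace X] (hm : m ≤ mX)
    {I : Type*} [Countable I] {b : X → I} (hb : ∀ i, MeasurableSet (b ⁻¹' {i})) :
    condEntS m μ b = ∫⁻ x, Hpart (ProbabilityTheory.condExpKernel μ m x) b ∂μ :=
  condEntS_eq_lintegral_Hpart b fun i =>
    ProbabilityTheory.condExpKernel_ae_eq_condExp hm (hb i)

theorem condExp_indicator_mem_Icc (hm : m ≤ mX) {B : Set X} (hB : MeasurableSet B) :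
    ∀ᵐ x ∂μ, (μ[B.indicator (fun _ => (1 : ℝ)) | m]) x ∈ Icc (0 : ℝ) 1 := by
  have h1 : 0 ≤ᵐ[μ] μ[B.indicator (fun _ => (1 : ℝ)) | m] :=
    condExp_nonneg (Eventually.of_forall fun x => indicator_nonneg (fun _ _ => zero_le_one) x)
  have h2 : μ[B.indicator (fun _ => (1 : ℝ)) | m] ≤ᵐ[μ] μ[(fun _ => (1 : ℝ)) | m] :=
    condExp_mono ((integrable_const (1 : ℝ)).indicator hB) (integrable_const 1)
      (Eventually.of_forall fun x => indicator_le_self' (fun _ _ => zero_le_one) x)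
  rw [condExp_const hm] at h2
  filter_upwards [h1, h2] with x a b using ⟨a, b⟩

theorem negMulLog_condExp_indicator_nonneg (hm : m ≤ mX) {B : Set X} (hB : MeasurableSet B) :
    0 ≤ᵐ[μ] Real.negMulLog ∘ μ[B.indicator (fun _ => (1 : ℝ)) | m] := by
  filter_upwards [condExp_indicator_mem_Icc hm hB] with x hx
    using Real.negMulLog_nonneg hx.1 hx.2

theorem integrable_negMulLog_condExp_indicator (hm : m ≤ mX) {B : Set X}
    (hB : MeasurableSet B) :
    Integrable (Real.negMulLog ∘ μ[B.indicator (fun _ => (1 : ℝ)) | m]) μ := by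
  refine Integrable.of_bound (C := 1)
    (Real.continuous_negMulLog.comp_aestronglyMeasurable
      integrable_condExp.aestronglyMeasurable) ?_
  filter_upwards [condExp_indicator_mem_Icc hm hB] with x hx
  rw [Real.norm_eq_abs, Function.comp_apply, abs_of_nonneg (Real.negMulLog_nonneg hx.1 hx.2)]
  linarith [Real.negMulLog_le_one_sub_self hx.1, hx.1]

/-- Conditioning on a larger σ-algebra decreases entropy. -/
theorem condEntS_anti (hmm : m ≤ m') (hm' : m' ≤ mX)
    {I : Type*} [Countable I] {b : X → I} (hb : ∀ i, MeasurableSet (b ⁻¹' {i})) :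
    condEntS m' μ b ≤ condEntS m μ b := by
  have hm : m ≤ mX := hmm.trans hm'
  have key : ∀ B : Set X, MeasurableSet B →
      ∫⁻ x, ENNReal.ofReal (Real.negMulLog ((μ[B.indicator (fun _ => (1 : ℝ)) | m']) x)) ∂μ ≤
      ∫⁻ x, ENNReal.ofReal (Real.negMulLog ((μ[B.indicator (fun _ => (1 : ℝ)) | m]) x)) ∂μ := by
    intro B hB
    set f := B.indicator (fun _ => (1 : ℝ)) with hf
    have hJ := Real.concaveOn_negMulLog.condExp_map_le hm
      (Real.continuous_negMulLog.upperSemicontinuous.upperSemicontinuousOn _)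
      (by filter_upwards [condExp_indicator_mem_Icc hm' hB] with x hx using hx.1) isClosed_Ici
      (integrable_condExp (m := m') (f := f) (μ := μ))
      (integrable_negMulLog_condExp_indicator hm' hB)
    have hle : ∫ x, (Real.negMulLog ∘ μ[f | m']) x ∂μ ≤
        ∫ x, (Real.negMulLog ∘ μ[f | m]) x ∂μ := by
      rw [← integral_condExp hm]
      refine integral_mono_ae integrable_condExp (integrable_negMulLog_condExp_indicator hm hB) ?_
      refine hJ.trans_eq ?_
      filter_upwards [condExp_condExp_of_le (f := f) (μ := μ) hmm hm'] with x hx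
      rw [Function.comp_apply, Function.comp_apply, hx]
    have h := ofReal_integral_eq_lintegral_ofReal
      (integrable_negMulLog_condExp_indicator (μ := μ) hm hB)
      (negMulLog_condExp_indicator_nonneg hm hB)
    have h' := ofReal_integral_eq_lintegral_ofReal
      (integrable_negMulLog_condExp_indicator (μ := μ) hm' hB)
      (negMulLog_condExp_indicator_nonneg hm' hB)
    refine (h'.symm.le.trans ?_).trans h.le
    exact ENNReal.ofReal_le_ofReal hle
  unfold condEntS
  rw [lintegral_tsum fun i => aemeasurable_negMulLog_condExp_indicator _,
    lintegral_tsum fun i => aemeasurable_negMulLog_condExp_indicator _]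
  exact ENNReal.tsum_le_tsum fun i => key _ (hb i)

theorem condEntS_bot {I : Type*} [Countable I] {b : X → I}
    (hb : ∀ i, MeasurableSet (b ⁻¹' {i})) : condEntS ⊥ μ b = Hpart μ b := by
  unfold condEntS Hpart
  simp only [condExp_bot, integral_indicator (hb _)]
  simp [measureReal_def]

end CondEntropy

section ChainRule

variable {X I J : Type*}

/-- On each cell of a countable partition `c`, every set of `m ⊔ σ(c)` agrees with a set
of `m`. -/
theorem exists_inter_fiber_eq {m : MeasurableSpace X} (c : X → J) {D : Set X}
    (hD : MeasurableSet[m ⊔ MeasurableSpace.comap c ⊤] D) (j : J) :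
    ∃ M, MeasurableSet[m] M ∧ D ∩ c ⁻¹' {j} = M ∩ c ⁻¹' {j} := by
  let v : (c ⁻¹' {j} : Set X) → X := Subtype.val
  have hle : m ⊔ MeasurableSpace.comap c ⊤ ≤ (m.comap v).map v := by
    refine sup_le MeasurableSpace.le_map_comap ?_
    rintro _ ⟨s, -, rfl⟩
    have hv : ∀ x, c (v x) = j := fun x => x.2
    change MeasurableSet[m.comap v] _
    by_cases hj : j ∈ s
    · have : v ⁻¹' (c ⁻¹' s) = univ := by ext x; simp [hv, hj]
      rw [this]; exact @MeasurableSet.univ _ (m.comap v)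
    · have : v ⁻¹' (c ⁻¹' s) = ∅ := by ext x; simp [hv, hj]
      rw [this]; exact @MeasurableSet.empty _ (m.comap v)
  obtain ⟨M, hM, h⟩ := hle D hD
  refine ⟨M, hM, ?_⟩
  rw [inter_comm D, inter_comm M, ← Subtype.image_preimage_coe, ← Subtype.image_preimage_coe]
  exact congrArg _ h.symm

variable [Countable I] [Countable J]

theorem lintegral_eq_tsum_fiber [MeasurableSpace X] {ρ : Measure X} {c : X → J}
    (hc : ∀ j, MeasurableSet (c ⁻¹' {j})) (G : J → X → ℝ≥0∞) :
    ∫⁻ x, G (c x) x ∂ρ = ∑' j, ∫⁻ x in c ⁻¹' {j}, G j x ∂ρ := by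
  have hU : ⋃ j, c ⁻¹' {j} = univ := by
    ext x; simp
  rw [← setLIntegral_univ, ← hU, lintegral_iUnion hc fun i j hij => ?_]
  · refine tsum_congr fun j => setLIntegral_congr_fun (hc j) fun x hx => ?_
    rw [mem_preimage, mem_singleton_iff] at hx
    simp only [hx]
  · exact Disjoint.preimage _ (by simpa using hij)

theorem Hpart_prodMk [MeasurableSpace X] (P : Measure X) [IsProbabilityMeasure P]
    {b : X → I} {c : X → J} (hb : ∀ i, MeasurableSet (b ⁻¹' {i}))
    (hc : ∀ j, MeasurableSet (c ⁻¹' {j})) :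
    Hpart P (fun x => (b x, c x)) = Hpart P c + condEntP P b c := by
  unfold Hpart condEntP
  have hpre : ∀ q : I × J, (fun x => (b x, c x)) ⁻¹' {q} = b ⁻¹' {q.1} ∩ c ⁻¹' {q.2} := by
    rintro ⟨i, j⟩; ext x; simp
  have hterm : ∀ q : I × J,
      ENNReal.ofReal (Real.negMulLog (P (b ⁻¹' {q.1} ∩ c ⁻¹' {q.2})).toReal) =
      P (b ⁻¹' {q.1} ∩ c ⁻¹' {q.2}) / P (c ⁻¹' {q.2}) *
        ENNReal.ofReal (Real.negMulLog (P (c ⁻¹' {q.2})).toReal) +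
      P (c ⁻¹' {q.2}) * ENNReal.ofReal (Real.negMulLog
        ((P (b ⁻¹' {q.1} ∩ c ⁻¹' {q.2})).toReal / (P (c ⁻¹' {q.2})).toReal)) := by
    rintro ⟨i, j⟩
    simp only
    set p := P (b ⁻¹' {i} ∩ c ⁻¹' {j}) with hp
    set q := P (c ⁻¹' {j}) with hq
    have hpq : p ≤ q := measure_mono inter_subset_right
    have hqt : q ≠ ∞ := measure_ne_top _ _
    have hpt : p ≠ ∞ := measure_ne_top _ _
    rcases eq_or_ne q 0 with h0 | h0
    · have : p = 0 := le_antisymm (h0 ▸ hpq) (zero_le)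
      simp [this, h0]
    · have hq0 : 0 < q.toReal := ENNReal.toReal_pos h0 hqt
      have hq1 : q.toReal ≤ 1 :=
        ENNReal.toReal_le_of_le_ofReal zero_le_one (by simpa using prob_le_one)
      have hle : p.toReal ≤ q.toReal := ENNReal.toReal_mono hqt hpq
      have ht0 : 0 ≤ p.toReal / q.toReal := by positivity
      have ht1 : p.toReal / q.toReal ≤ 1 := (div_le_one hq0).2 hle
      have hdiv : p / q = ENNReal.ofReal (p.toReal / q.toReal) := by
        rw [ENNReal.ofReal_div_of_pos hq0, ENNReal.ofReal_toReal hpt, ENNReal.ofReal_toReal hqt]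
      have hqq : q = ENNReal.ofReal q.toReal := (ENNReal.ofReal_toReal hqt).symm
      rw [hdiv, ← ENNReal.ofReal_mul ht0]
      nth_rw 3 [hqq]
      rw [← ENNReal.ofReal_mul hq0.le, ← ENNReal.ofReal_add
        (mul_nonneg ht0 (Real.negMulLog_nonneg hq0.le hq1))
        (mul_nonneg hq0.le (Real.negMulLog_nonneg ht0 ht1)), ← Real.negMulLog_mul,
        mul_div_cancel₀ _ hq0.ne']
  simp only [hpre]
  rw [tsum_congr hterm, ENNReal.tsum_add]
  congr 1
  rw [ENNReal.tsum_prod', ENNReal.tsum_comm]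
  refine tsum_congr fun j => ?_
  simp only
  rw [ENNReal.tsum_mul_right]
  rcases eq_or_ne (P (c ⁻¹' {j})) 0 with h0 | h0
  · simp [h0]
  · have hsum : ∑' i, P (b ⁻¹' {i} ∩ c ⁻¹' {j}) = P (c ⁻¹' {j}) := by
      rw [← measure_iUnion (fun i i' hii => ?_) fun i => (hb i).inter (hc j)]
      · congr 1; ext x; simp
      · exact (Disjoint.preimage _ (by simpa using hii)).mono inter_subset_left inter_subset_left
    simp only [div_eq_mul_inv]
    rw [ENNReal.tsum_mul_right, hsum, ENNReal.mul_inv_cancel h0 (measure_ne_top _ _), one_mul]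

variable {m : MeasurableSpace X} [mX : MeasurableSpace X]
  {μ : Measure X} [IsProbabilityMeasure μ]

theorem comap_top_le {c : X → J} (hc : ∀ j, MeasurableSet (c ⁻¹' {j})) :
    MeasurableSpace.comap c ⊤ ≤ mX := by
  rintro _ ⟨s, -, rfl⟩
  rw [← biUnion_of_singleton s, preimage_iUnion₂]
  exact MeasurableSet.biUnion s.to_countable fun j _ => hc j

variable [StandardBorelSpace X]

/-- The conditional probability given `m ⊔ σ(c)` for a countable partition `c`. -/
theorem condExp_sup_comap_ae_eq (hm : m ≤ mX) {c : X → J}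
    (hc : ∀ j, MeasurableSet (c ⁻¹' {j})) {B : Set X} (hB : MeasurableSet B) :
    (fun x => (ProbabilityTheory.condExpKernel μ m x (B ∩ c ⁻¹' {c x}) /
      ProbabilityTheory.condExpKernel μ m x (c ⁻¹' {c x})).toReal) =ᵐ[μ]
    μ[B.indicator (fun _ => (1 : ℝ)) | m ⊔ MeasurableSpace.comap c ⊤] := by
  have hle : m ⊔ MeasurableSpace.comap c ⊤ ≤ mX := sup_le hm (comap_top_le hc)
  set κ := ProbabilityTheory.condExpKernel μ m with hκ
  have hg : ∀ j, Measurable[m] fun x => κ x (B ∩ c ⁻¹' {j}) / κ x (c ⁻¹' {j}) := fun j =>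
    (ProbabilityTheory.measurable_condExpKernel (hB.inter (hc j))).div
      (ProbabilityTheory.measurable_condExpKernel (hc j))
  refine toReal_ae_eq_condExp_indicator hle hB
    (f := fun x => κ x (B ∩ c ⁻¹' {c x}) / κ x (c ⁻¹' {c x})) ?_ fun D hD => ?_
  · let _ : MeasurableSpace J := ⊤
    have h1 : @Measurable (J × X) ℝ≥0∞ (@Prod.instMeasurableSpace J X ⊤ m) _
        fun p => κ p.2 (B ∩ c ⁻¹' {p.1}) / κ p.2 (c ⁻¹' {p.1}) :=
      @measurable_from_prod_countable_right J X ℝ≥0∞ ⊤ m _ _ _ _ fun j => hg j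
    have h2 : @Measurable X (J × X) (m ⊔ MeasurableSpace.comap c ⊤)
        (@Prod.instMeasurableSpace J X ⊤ m) fun x => (c x, x) :=
      @Measurable.prodMk X (m ⊔ MeasurableSpace.comap c ⊤) J X ⊤ m _ _
        ((comap_measurable c).mono le_sup_right le_rfl) (measurable_id'' le_sup_left)
    exact h1.comp h2
  · rw [lintegral_eq_tsum_fiber hc fun j x => κ x (B ∩ c ⁻¹' {j}) / κ x (c ⁻¹' {j})]
    have hD' : D ∩ B = ⋃ j, D ∩ (B ∩ c ⁻¹' {j}) := by
      ext x; simp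
    rw [hD', measure_iUnion (fun i j hij => ?_) fun j => (hle _ hD).inter (hB.inter (hc j))]
    · refine tsum_congr fun j => ?_
      obtain ⟨M, hM, hDM⟩ := exists_inter_fiber_eq c hD j
      have hset : D ∩ (B ∩ c ⁻¹' {j}) = M ∩ (B ∩ c ⁻¹' {j}) := by
        rw [inter_left_comm, hDM, inter_left_comm]
      rw [Measure.restrict_restrict (hc j), inter_comm, hDM, hset,
        ← Measure.restrict_restrict (hm _ hM), ← setLIntegral_condExpKernel hm hM (hB.inter (hc j)),
        ← lintegral_indicator (hm _ hM), ← lintegral_indicator (hm _ hM),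
        setLIntegral_eq_lintegral_condExpKernel_mul hm (hc j) ((hg j).indicator hM)]
      refine lintegral_congr fun x => ?_
      by_cases hx : x ∈ M
      · simp only [indicator_of_mem hx]
        rw [ENNReal.mul_div_cancel']
        · intro h0
          exact measure_mono_null inter_subset_right h0
        · intro h; exact absurd h (measure_ne_top _ _)
      · simp [hx]
    · exact (Disjoint.preimage c (show Disjoint {i} {j} by simpa using hij)).mono
        (fun x hx => hx.2.2) fun x hx => hx.2.2

/-- Chain rule for conditional entropy. -/
theorem condEntS_prodMk (hm : m ≤ mX) {b : X → I} {c : X → J}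
    (hb : ∀ i, MeasurableSet (b ⁻¹' {i})) (hc : ∀ j, MeasurableSet (c ⁻¹' {j})) :
    condEntS m μ (fun x => (b x, c x)) =
      condEntS m μ c + condEntS (m ⊔ MeasurableSpace.comap c ⊤) μ b := by
  set κ := ProbabilityTheory.condExpKernel μ m with hκ
  have hκm : ∀ {s : Set X}, MeasurableSet s → Measurable[m] fun x => κ x s := fun hs =>
    ProbabilityTheory.measurable_condExpKernel hs
  have hpair : ∀ q : I × J, MeasurableSet ((fun x => (b x, c x)) ⁻¹' {q}) := by
    rintro ⟨i, j⟩
    have : (fun x => (b x, c x)) ⁻¹' {(i, j)} = b ⁻¹' {i} ∩ c ⁻¹' {j} := by ext x; simp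
    rw [this]; exact (hb i).inter (hc j)
  rw [condEntS_eq_lintegral_condExpKernel hm hpair, condEntS_eq_lintegral_condExpKernel hm hc]
  simp_rw [Hpart_prodMk _ hb hc]
  have hH : Measurable fun x => Hpart (κ x) c := by
    refine Measurable.tsum fun j => ?_
    exact (Real.continuous_negMulLog.measurable.comp
      ((hκm (hc j)).mono hm le_rfl).ennreal_toReal).ennreal_ofReal
  rw [lintegral_add_left hH]
  congr 1
  let G : J → X → ℝ≥0∞ := fun j x => ∑' i, ENNReal.ofReal (Real.negMulLog
    ((κ x (b ⁻¹' {i} ∩ c ⁻¹' {j})).toReal / (κ x (c ⁻¹' {j})).toReal))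
  have hG : ∀ j, Measurable[m] (G j) := fun j =>
    @Measurable.tsum X _ _ m _ _ _ _ _ _ _ _ _ _ _ _ fun i =>
    (Real.continuous_negMulLog.measurable.comp ((hκm ((hb i).inter (hc j))).ennreal_toReal.div
      (hκm (hc j)).ennreal_toReal)).ennreal_ofReal
  have h1 : condEntS (m ⊔ MeasurableSpace.comap c ⊤) μ b = ∫⁻ x, G (c x) x ∂μ := by
    refine lintegral_congr_ae ?_
    filter_upwards [ae_all_iff.2 fun i => condExp_sup_comap_ae_eq (μ := μ) hm hc (hb i)] with x hx
    refine tsum_congr fun i => ?_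
    rw [← hx i, ENNReal.toReal_div]
  rw [h1, lintegral_eq_tsum_fiber hc G]
  simp_rw [fun j => setLIntegral_eq_lintegral_condExpKernel_mul (μ := μ) hm (hc j) (hG j)]
  have hκG : ∀ j, AEMeasurable (fun x => κ x (c ⁻¹' {j}) * G j x) μ := fun j =>
    (((hκm (hc j)).mul (hG j)).mono hm le_rfl).aemeasurable
  rw [← lintegral_tsum hκG]
  refine lintegral_congr fun x => ?_
  unfold condEntP
  rw [ENNReal.tsum_prod', ENNReal.tsum_comm]
  refine tsum_congr fun j => ?_
  simp only
  rw [ENNReal.tsum_mul_left]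

end ChainRule

section Translates

variable {G X : Type*} [Group G] {m : MeasurableSpace X} [mX : MeasurableSpace X]
  {T : BorelAction G X} {a : X → ℕ}

theorem measurableSet_joinF_fiber (ha : Measurable a) (F : Set G) [Finite F] (v : F → ℕ) :
    MeasurableSet (T.joinF F a ⁻¹' {v}) := by
  have : T.joinF F a ⁻¹' {v} = ⋂ f : F, (fun x => a (T.act (f : G)⁻¹ x)) ⁻¹' {v f} := by
    ext x
    simp [BorelAction.joinF, funext_iff]
  rw [this]
  exact MeasurableSet.iInter fun f =>
    (ha.comp (T.measurable_act _)) (MeasurableSet.singleton _)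

theorem comap_joinF (T : BorelAction G X) (F : Set G) [Finite F] (a : X → ℕ) :
    MeasurableSpace.comap (T.joinF F a) ⊤ = T.partSA F a := by
  have htop : (⊤ : MeasurableSpace (F → ℕ)) = MeasurableSpace.pi :=
    le_antisymm (fun s _ => s.to_countable.measurableSet) le_top
  rw [htop, MeasurableSpace.pi, MeasurableSpace.comap_iSup, BorelAction.partSA, iSup_subtype']
  refine iSup_congr fun f => ?_
  rw [MeasurableSpace.comap_comp]
  rfl

theorem partSA_mono {F K : Set G} (h : F ⊆ K) : T.partSA F a ≤ T.partSA K a :=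
  biSup_mono h

theorem partSA_le (ha : Measurable a) (F : Set G) : T.partSA F a ≤ mX :=
  iSup₂_le fun f _ => by
    rintro _ ⟨s, -, rfl⟩
    exact (ha.comp (T.measurable_act _)) (MeasurableSet.of_discrete (s := s))

variable {μ : Measure X}

theorem condEntS_joinF_congr {F K : Set G} [Finite F] [Finite K] (h : F = K) :
    condEntS m μ (T.joinF F a) = condEntS m μ (T.joinF K a) := by
  subst h; rfl

theorem condEntS_joinF_prodMk (F K : Set G) [Finite F] [Finite K] :
    condEntS m μ (fun x => (T.joinF K a x, T.joinF F a x)) =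
      condEntS m μ (T.joinF (F ∪ K) a) := by
  let e : (↥(F ∪ K) → ℕ) → (K → ℕ) × (F → ℕ) := fun v =>
    (fun k => v ⟨k, Or.inr k.2⟩, fun f => v ⟨f, Or.inl f.2⟩)
  have he : Function.Injective e := by
    intro v w h
    funext ⟨f, hf⟩
    rcases hf with hf | hf
    · exact congrFun (congrArg Prod.snd h) ⟨f, hf⟩
    · exact congrFun (congrArg Prod.fst h) ⟨f, hf⟩
  exact condEntS_injective_comp he (T.joinF (F ∪ K) a)

theorem exists_injective_joinF_comp_act (T : BorelAction G X) (a : X → ℕ) (F : Set G) (g : G) :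
    ∃ e : (↥((fun h => g * h) '' F) → ℕ) → (F → ℕ), Function.Injective e ∧
      T.joinF F a ∘ T.act g⁻¹ = e ∘ T.joinF ((fun h => g * h) '' F) a := by
  refine ⟨fun v f => v ⟨g * f, f, f.2, rfl⟩, fun v w h => ?_, ?_⟩
  · funext ⟨_, f, hf, rfl⟩
    exact congrFun h ⟨f, hf⟩
  · funext x f
    simp [BorelAction.joinF, T.act_mul]

theorem condEntS_tr_joinF_prodMk (F : Set G) [Finite F] (g : G) :
    condEntS m μ (fun x => (T.tr g (T.joinF F a) x, T.joinF F a x)) =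
      condEntS m μ (T.joinF (F ∪ (fun h => g * h) '' F) a) := by
  obtain ⟨e, he, hcomp⟩ := exists_injective_joinF_comp_act T a F g
  rw [← condEntS_joinF_prodMk, ← condEntS_injective_comp (he.prodMap Function.injective_id)]
  congr 1
  funext x
  exact Prod.ext (congrFun hcomp x) rfl

variable [StandardBorelSpace X] [IsProbabilityMeasure μ]

/-- Conditional entropy given an invariant σ-algebra is invariant under the action. -/
theorem condEntS_comp_act (hT : T.Preserves μ) (hm : InvariantSA m T) {I : Type*} [Countable I]
    {b : X → I} (hb : ∀ i, MeasurableSet (b ⁻¹' {i})) (g : G) :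
    condEntS m μ (b ∘ T.act g) = condEntS m μ b := by
  set κ := ProbabilityTheory.condExpKernel μ m with hκ
  have hκm : ∀ {s : Set X}, MeasurableSet s → Measurable[m] fun x => κ x s := fun hs =>
    ProbabilityTheory.measurable_condExpKernel hs
  have hTm : Measurable[m, m] (T.act g) := fun A hA => hm.2 g A hA
  have hH : Measurable fun x => Hpart (κ x) b :=
    Measurable.tsum fun i => (Real.continuous_negMulLog.measurable.comp
      ((hκm (hb i)).mono hm.1 le_rfl).ennreal_toReal).ennreal_ofReal
  have hmap : ∀ x i, (κ (T.act g x)).map (T.act g⁻¹) ((b ∘ T.act g) ⁻¹' {i}) =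
      κ (T.act g x) (b ⁻¹' {i}) := by
    intro x i
    rw [preimage_comp, Measure.map_apply (T.measurable_act _) (T.measurable_act g (hb i))]
    congr 1
    ext y; simp [← T.act_mul, T.act_one]
  rw [condEntS_eq_lintegral_condExpKernel hm.1 hb, ← (hT g).lintegral_comp hH,
    condEntS_eq_lintegral_Hpart (κ := fun x => (κ (T.act g x)).map (T.act g⁻¹))]
  · simp only [Hpart, hmap]
  · intro i
    refine toReal_ae_eq_condExp_indicator hm.1 (T.measurable_act g (hb i)) ?_ fun A hA => ?_
    · simp only [hmap]
      exact (hκm (hb i)).comp hTm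
    · have hA' : A = T.act g ⁻¹' (T.act g⁻¹ ⁻¹' A) := by
        ext y; simp [← T.act_mul, T.act_one]
      have hgA := hm.2 g⁻¹ A hA
      simp only [hmap]
      rw [hA',
        (hT g).setLIntegral_comp_preimage (hm.1 _ hgA) ((hκm (hb i)).mono hm.1 le_rfl),
        setLIntegral_condExpKernel hm.1 hgA (hb i), ← preimage_inter,
        (hT g).measure_preimage ((hm.1 _ hgA).inter (hb i)).nullMeasurableSet]

theorem condEntS_joinF_image_mul (hT : T.Preserves μ) (hm : InvariantSA m T)
    (ha : Measurable a) (F : Set G) [Finite F] (g : G) :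
    condEntS m μ (T.joinF ((fun h => g * h) '' F) a) = condEntS m μ (T.joinF F a) := by
  obtain ⟨e, he, hcomp⟩ := exists_injective_joinF_comp_act T a F g
  rw [← condEntS_injective_comp he, ← hcomp,
    condEntS_comp_act hT hm (measurableSet_joinF_fiber ha F)]

theorem condEntS_joinF_union (hm : m ≤ mX) (ha : Measurable a) (F K : Set G)
    [Finite F] [Finite K] :
    condEntS m μ (T.joinF (F ∪ K) a) =
      condEntS m μ (T.joinF F a) + condEntS (m ⊔ T.partSA F a) μ (T.joinF K a) := by
  rw [← condEntS_joinF_prodMk, condEntS_prodMk hm (measurableSet_joinF_fiber ha K)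
    (measurableSet_joinF_fiber ha F), comap_joinF]

theorem condEntS_joinF_of_subset (hm : m ≤ mX) (ha : Measurable a) {F K : Set G}
    [Finite F] [Finite K] (h : F ⊆ K) :
    condEntS m μ (T.joinF K a) =
      condEntS m μ (T.joinF F a) + condEntS (m ⊔ T.partSA F a) μ (T.joinF K a) := by
  rw [← condEntS_joinF_union hm ha, condEntS_joinF_congr (union_eq_self_of_subset_left h)]

theorem condEntS_joinF_mono (hm : m ≤ mX) (ha : Measurable a) {F K : Set G}
    [Finite F] [Finite K] (h : F ⊆ K) :
    condEntS m μ (T.joinF F a) ≤ condEntS m μ (T.joinF K a) := by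
  rw [condEntS_joinF_of_subset hm ha h]
  exact le_self_add

theorem condEntS_joinF_submodular (hm : m ≤ mX) (ha : Measurable a) (F K : Set G)
    [Finite F] [Finite K] :
    condEntS m μ (T.joinF (F ∪ K) a) + condEntS m μ (T.joinF (F ∩ K : Set G) a) ≤
      condEntS m μ (T.joinF F a) + condEntS m μ (T.joinF K a) := by
  rw [condEntS_joinF_union hm ha F K,
    condEntS_joinF_of_subset hm ha (inter_subset_right : F ∩ K ⊆ K), add_assoc,
    add_comm (condEntS m μ (T.joinF (F ∩ K : Set G) a))]
  gcongr
  exact condEntS_anti (sup_le_sup_left (partSA_mono inter_subset_left) m)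
    (sup_le hm (partSA_le ha F)) (measurableSet_joinF_fiber ha K)

theorem condEntS_joinF_lt_top (hT : T.Preserves μ) (hm : InvariantSA m T)
    (ha : Measurable a) (hent : Hpart μ a < ⊤) (F : Finset G) :
    condEntS m μ (T.joinF (F : Set G) a) < ⊤ := by
  classical
  have hone : condEntS m μ (T.joinF ({1} : Set G) a) < ⊤ := by
    have he : Function.Injective (fun (n : ℕ) (_ : ({1} : Set G)) => n) := fun n k h =>
      congrFun h ⟨1, rfl⟩
    have hcomp : T.joinF ({1} : Set G) a = (fun (n : ℕ) (_ : ({1} : Set G)) => n) ∘ a := by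
      funext x ⟨f, hf⟩
      obtain rfl : f = 1 := hf
      simp [BorelAction.joinF, T.act_one]
    have hfib : ∀ i, MeasurableSet (a ⁻¹' {i}) := fun i => ha (MeasurableSet.singleton i)
    rw [hcomp, condEntS_injective_comp he]
    exact (condEntS_anti bot_le hm.1 hfib).trans_lt ((condEntS_bot hfib).trans_lt hent)
  have hsing : ∀ g : G, condEntS m μ (T.joinF ({g} : Set G) a) < ⊤ := by
    intro g
    have : ({g} : Set G) = (fun h => g * h) '' {1} := by simp
    rw [condEntS_joinF_congr this, condEntS_joinF_image_mul hT hm ha]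
    exact hone
  induction F using Finset.induction_on with
  | empty =>
    refine (condEntS_joinF_mono hm.1 ha ?_).trans_lt hone
    simp
  | insert g F _ ih =>
    have hcoe : ((insert g F : Finset G) : Set G) = {g} ∪ (F : Set G) := by
      rw [Finset.coe_insert, insert_eq]
    rw [condEntS_joinF_congr hcoe]
    exact (le_self_add.trans (condEntS_joinF_submodular hm.1 ha {g} (F : Set G))).trans_lt
      (ENNReal.add_lt_top.2 ⟨hsing g, ih⟩)

end Translates

section Growth

theorem tendsto_const_rpow_inv_natCast {C : ℝ} (hC : 0 < C) :
    Tendsto (fun n : ℕ => C ^ ((n : ℝ)⁻¹)) atTop (nhds 1) := by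
  have h := (Real.continuousAt_const_rpow (b := 0) hC.ne').tendsto.comp
    (tendsto_inv_atTop_zero.comp (tendsto_natCast_atTop_atTop (R := ℝ)))
  rw [Real.rpow_zero] at h
  exact h

theorem tendsto_const_mul_pow_rpow_inv_natCast {C q : ℝ} (hC : 0 < C) (hq : 0 ≤ q) :
    Tendsto (fun n : ℕ => (C * q ^ n) ^ ((n : ℝ)⁻¹)) atTop (nhds q) := by
  have h := (tendsto_const_rpow_inv_natCast hC).mul_const q
  rw [one_mul] at h
  refine h.congr' ?_
  filter_upwards [eventually_ne_atTop 0] with n hn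
  rw [Real.mul_rpow hC.le (pow_nonneg hq n), Real.pow_rpow_inv_natCast hq hn]

/-- Exponential growth rate of the increments of an unbounded sequence which satisfies
`A (n + 1) ≥ q * A n + c` and whose increments grow at most by a factor of `q`. -/
theorem tendsto_increment_rpow_inv {A : ℕ → ℝ} {q c : ℝ} (hq : 1 < q)
    (hup : ∀ n, A (n + 2) - A (n + 1) ≤ q * (A (n + 1) - A n))
    (hlow : ∀ n, q * A n + c ≤ A (n + 1)) (hA : ∀ M, ∃ n, M < A n) :
    Tendsto (fun n : ℕ => (A (n + 1) - A n) ^ ((n : ℝ)⁻¹)) atTop (nhds q) := by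
  have hq0 : 0 < q := one_pos.trans hq
  have hq1 : 0 < q - 1 := sub_pos.2 hq
  have hupper : ∀ n, A (n + 1) - A n ≤ (|A 1 - A 0| + 1) * q ^ n := by
    intro n
    induction n with
    | zero =>
      rw [pow_zero, mul_one, zero_add]
      exact (le_abs_self _).trans (le_add_of_nonneg_right zero_le_one)
    | succ n ih =>
      calc A (n + 1 + 1) - A (n + 1) ≤ q * (A (n + 1) - A n) := hup n
        _ ≤ q * ((|A 1 - A 0| + 1) * q ^ n) := by gcongr
        _ = _ := by ring
  obtain ⟨N, hN⟩ := hA (-(c / (q - 1)))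
  have hpos : 0 < (q - 1) * A N + c := by
    have := mul_lt_mul_of_pos_left hN hq1
    rw [mul_neg, mul_div_cancel₀ _ hq1.ne'] at this
    linarith
  have hlower : ∀ k, ((q - 1) * A N + c) * q ^ k ≤ (q - 1) * A (N + k) + c := by
    intro k
    induction k with
    | zero => simp
    | succ k ih =>
      calc ((q - 1) * A N + c) * q ^ (k + 1) = q * (((q - 1) * A N + c) * q ^ k) := by ring
        _ ≤ q * ((q - 1) * A (N + k) + c) := by gcongr
        _ = (q - 1) * (q * A (N + k) + c) + c := by ring
        _ ≤ (q - 1) * A (N + (k + 1)) + c := by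
          have := hlow (N + k)
          gcongr
          exact this
  have hlower' : ∀ n, N ≤ n → (((q - 1) * A N + c) / q ^ N) * q ^ n ≤ A (n + 1) - A n := by
    intro n hn
    obtain ⟨k, rfl⟩ := Nat.exists_eq_add_of_le hn
    rw [pow_add, ← mul_assoc, div_mul_cancel₀ _ (pow_pos hq0 N).ne']
    have := hlower k
    have := hlow (N + k)
    linarith
  refine tendsto_of_tendsto_of_tendsto_of_le_of_le'
    (tendsto_const_mul_pow_rpow_inv_natCast (div_pos hpos (pow_pos hq0 N)) hq0.le)
    (tendsto_const_mul_pow_rpow_inv_natCast (C := |A 1 - A 0| + 1) (by positivity) hq0.le) ?_ ?_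
  · filter_upwards [eventually_ge_atTop N] with n hn
    have : 0 < ((q - 1) * A N + c) / q ^ N * q ^ n := by positivity
    exact Real.rpow_le_rpow this.le (hlower' n hn) (by positivity)
  · filter_upwards [eventually_ge_atTop N] with n hn
    have : 0 < ((q - 1) * A N + c) / q ^ N * q ^ n := by positivity
    exact Real.rpow_le_rpow (this.le.trans (hlower' n hn)) (hupper n) (by positivity)

end Growth

section Submodular

variable {G : Type*} [DecidableEq G] {h : Finset G → ℝ}

/-- Subadditivity of a monotone submodular set function relative to a common subset. -/
theorem biUnion_add_le_sum_of_submodular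
    (hsub : ∀ F K, h (F ∪ K) + h (F ∩ K) ≤ h F + h K) (hmono : ∀ F K, F ⊆ K → h F ≤ h K)
    {ι : Type*} {J : Finset ι} (hJ : J.Nonempty) (K : ι → Finset G) (B : Finset G)
    (hB : ∀ p, B ⊆ K p) :
    h (J.biUnion K) + ((J.card : ℝ) - 1) * h B ≤ ∑ p ∈ J, h (K p) := by
  classical
  induction hJ using Finset.Nonempty.cons_induction with
  | singleton p => simp
  | cons p J hp hJ ih =>
    obtain ⟨p', hp'⟩ := hJ
    have hinter : B ⊆ K p ∩ J.biUnion K :=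
      Finset.subset_inter (hB p) ((hB p').trans (Finset.subset_biUnion_of_mem K hp'))
    have h₁ := hsub (K p) (J.biUnion K)
    have h₂ := hmono _ _ hinter
    rw [Finset.cons_eq_insert, Finset.biUnion_insert, Finset.card_insert_of_notMem hp,
      Finset.sum_insert hp]
    push_cast
    linarith

end Submodular

section FreeGroupBall

variable {r : ℕ}

theorem letter_eq_mk (p : Fin r × Bool) : letter p = FreeGroup.mk [p] := by
  obtain ⟨i, b⟩ := p
  cases b <;> rfl

theorem wlen_letter_mul_le (p : Fin r × Bool) (g : FG r) : wlen (letter p * g) ≤ wlen g + 1 := by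
  rw [letter_eq_mk, add_comm]
  exact (FreeGroup.norm_mul_le _ _).trans (Nat.add_le_add_right FreeGroup.norm_mk_le _)

theorem wlen_letter_inv_mul_le (p : Fin r × Bool) (g : FG r) :
    wlen ((letter p)⁻¹ * g) ≤ wlen g + 1 := by
  have : (letter p)⁻¹ = letter (p.1, !p.2) := by
    rw [letter_eq_mk, letter_eq_mk]
    rfl
  rw [this]
  exact wlen_letter_mul_le _ g

theorem exists_letter_mul {g : FG r} (hg : g ≠ 1) :
    ∃ (p : Fin r × Bool) (k : FG r), letter p * k = g ∧ wlen k + 1 ≤ wlen g := by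
  obtain ⟨p, l, hl⟩ : ∃ p l, g.toWord = p :: l :=
    List.exists_cons_of_ne_nil (mt FreeGroup.toWord_eq_nil_iff.1 hg)
  refine ⟨p, FreeGroup.mk l, ?_, ?_⟩
  · rw [letter_eq_mk, FreeGroup.mul_mk, List.singleton_append, ← hl, FreeGroup.mk_toWord]
  · have : wlen g = l.length + 1 := by rw [wlen, hl, List.length_cons]
    rw [this]
    exact Nat.add_le_add_right FreeGroup.norm_mk_le 1

/-- The ball of radius `n` in the free group, as a finset. -/
noncomputable def ballFinset (r n : ℕ) : Finset (FG r) := (Set.toFinite (ball r n)).toFinset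

theorem coe_ballFinset (n : ℕ) : (ballFinset r n : Set (FG r)) = ball r n :=
  Set.Finite.coe_toFinset _

theorem mem_ballFinset {n : ℕ} {g : FG r} : g ∈ ballFinset r n ↔ wlen g ≤ n :=
  Set.Finite.mem_toFinset _

/-- The left translate of a finite set. -/
noncomputable def leftTranslate (g : FG r) (F : Finset (FG r)) : Finset (FG r) :=
  F.image (g * ·)

theorem mem_leftTranslate {g k : FG r} {F : Finset (FG r)} :
    k ∈ leftTranslate g F ↔ g⁻¹ * k ∈ F := by
  simp only [leftTranslate, Finset.mem_image]
  constructor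
  · rintro ⟨x, hx, rfl⟩
    simpa using hx
  · intro h
    exact ⟨_, h, by simp⟩

theorem ballFinset_succ_eq_biUnion_union (hr : 0 < r) (n : ℕ) :
    (Finset.univ.biUnion fun p : Fin r × Bool =>
      ballFinset r n ∪ leftTranslate (letter p) (ballFinset r n)) = ballFinset r (n + 1) := by
  ext g
  simp only [Finset.mem_biUnion, Finset.mem_univ, true_and, Finset.mem_union, mem_leftTranslate,
    mem_ballFinset]
  constructor
  · rintro ⟨p, h | h⟩
    · exact h.trans n.le_succ
    · have := wlen_letter_mul_le p ((letter p)⁻¹ * g)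
      rw [mul_inv_cancel_left] at this
      lia
  · intro h
    by_cases hg : g = 1
    · refine ⟨(⟨0, hr⟩, true), Or.inl ?_⟩
      simp [hg, wlen]
    · obtain ⟨p, k, rfl, hk⟩ := exists_letter_mul hg
      refine ⟨p, Or.inr ?_⟩
      rw [inv_mul_cancel_left]
      lia

theorem ballFinset_succ_eq_biUnion_inter (hr : 0 < r) (n : ℕ) :
    (Finset.univ.biUnion fun p : Fin r × Bool =>
      ballFinset r (n + 1) ∩ leftTranslate (letter p) (ballFinset r (n + 1))) =
        ballFinset r (n + 1) := by
  ext g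
  simp only [Finset.mem_biUnion, Finset.mem_univ, true_and, Finset.mem_inter, mem_leftTranslate,
    mem_ballFinset]
  refine ⟨fun ⟨p, h, _⟩ => h, fun h => ?_⟩
  by_cases hg : g = 1
  · refine ⟨(⟨0, hr⟩, true), h, ?_⟩
    have := wlen_letter_inv_mul_le (⟨0, hr⟩, true) g
    have : wlen g = 0 := by simp [hg, wlen]
    lia
  · obtain ⟨p, k, rfl, hk⟩ := exists_letter_mul hg
    refine ⟨p, h, ?_⟩
    rw [inv_mul_cancel_left]
    lia

theorem ballFinset_subset_inter (n : ℕ) (p : Fin r × Bool) :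
    ballFinset r n ⊆
      ballFinset r (n + 1) ∩ leftTranslate (letter p) (ballFinset r (n + 1)) := by
  intro g hg
  rw [mem_ballFinset] at hg
  simp only [Finset.mem_inter, mem_leftTranslate, mem_ballFinset]
  have := wlen_letter_inv_mul_le p g
  lia

variable {h : Finset (FG r) → ℝ}

theorem sum_letter_union_eq (hinv : ∀ F g, h (leftTranslate g F) = h F) (F : Finset (FG r)) :
    ∑ p : Fin r × Bool, h (F ∪ leftTranslate (letter p) F) =
      2 * ∑ i : Fin r, h (F ∪ leftTranslate (FreeGroup.of i) F) := by
  rw [Fintype.sum_prod_type, Finset.mul_sum]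
  refine Finset.sum_congr rfl fun i _ => ?_
  have hinv' : h (F ∪ leftTranslate (FreeGroup.of i)⁻¹ F) =
      h (F ∪ leftTranslate (FreeGroup.of i) F) := by
    rw [← hinv _ (FreeGroup.of i)]
    congr 1
    ext g
    simp [mem_leftTranslate, or_comm]
  rw [Fintype.sum_bool, two_mul]
  exact congrArg _ hinv'

/-- If `F_G` is bounded below along balls, an invariant monotone submodular function grows
exponentially along balls at rate `2 * r - 1`, unless it is bounded. -/
theorem tendsto_increment_ballFinset (hr : 1 < r)
    (hsub : ∀ F K, h (F ∪ K) + h (F ∩ K) ≤ h F + h K) (hmono : ∀ F K, F ⊆ K → h F ≤ h K)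
    (hinv : ∀ F g, h (leftTranslate g F) = h F) {c : ℝ}
    (hc : ∀ n, c ≤ (1 - 2 * (r : ℝ)) * h (ballFinset r n) +
      ∑ i : Fin r, h (ballFinset r n ∪ leftTranslate (FreeGroup.of i) (ballFinset r n)))
    (hunb : ∀ M, ∃ n, M < h (ballFinset r n)) :
    Tendsto (fun n : ℕ => (h (ballFinset r (n + 1)) - h (ballFinset r n)) ^ ((n : ℝ)⁻¹))
      atTop (nhds (2 * (r : ℝ) - 1)) := by
  have hr0 : 0 < r := one_pos.trans hr
  have hr1 : (1 : ℝ) < r := by exact_mod_cast hr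
  have hne : (Finset.univ : Finset (Fin r × Bool)).Nonempty := ⟨(⟨0, hr0⟩, true), by simp⟩
  have hcard : ((Finset.univ : Finset (Fin r × Bool)).card : ℝ) = 2 * r := by
    simp [mul_comm]
  have hupper : ∀ n, h (ballFinset r (n + 1)) + (2 * r - 1) * h (ballFinset r n) ≤
      2 * ∑ i : Fin r, h (ballFinset r n ∪ leftTranslate (FreeGroup.of i) (ballFinset r n)) := by
    intro n
    have := biUnion_add_le_sum_of_submodular hsub hmono hne
      (fun p => ballFinset r n ∪ leftTranslate (letter p) (ballFinset r n)) (ballFinset r n)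
      (fun p => Finset.subset_union_left)
    rwa [ballFinset_succ_eq_biUnion_union hr0, hcard, sum_letter_union_eq hinv] at this
  have hlower : ∀ n, 2 * ∑ i : Fin r, h (ballFinset r (n + 1) ∪
      leftTranslate (FreeGroup.of i) (ballFinset r (n + 1))) ≤
      (4 * r - 1) * h (ballFinset r (n + 1)) - (2 * r - 1) * h (ballFinset r n) := by
    intro n
    have h₁ := biUnion_add_le_sum_of_submodular hsub hmono hne _ (ballFinset r n)
      (ballFinset_subset_inter n)
    rw [ballFinset_succ_eq_biUnion_inter hr0, hcard] at h₁
    have h₂ : ∑ p : Fin r × Bool,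
        (h (ballFinset r (n + 1) ∪ leftTranslate (letter p) (ballFinset r (n + 1))) +
          h (ballFinset r (n + 1) ∩ leftTranslate (letter p) (ballFinset r (n + 1)))) ≤
        ∑ _p : Fin r × Bool, 2 * h (ballFinset r (n + 1)) := by
      refine Finset.sum_le_sum fun p _ => (hsub _ _).trans_eq ?_
      rw [hinv, two_mul]
    rw [Finset.sum_add_distrib, sum_letter_union_eq hinv, Finset.sum_const, nsmul_eq_mul,
      hcard] at h₂
    linarith
  refine tendsto_increment_rpow_inv (A := fun n => h (ballFinset r n)) (c := 2 * c)
    (by linarith) (fun n => ?_) (fun n => ?_) hunb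
  · have h₁ := hupper (n + 1)
    have h₂ := hlower n
    linarith
  · have h₁ := hc (n + 1)
    have h₂ := hlower n
    linarith

end FreeGroupBall

section Atoms

variable {X : Type*} [mX : MeasurableSpace X] {ρ : Measure X} [IsProbabilityMeasure ρ]

/-- Markov's inequality for the information function of a partition. -/
theorem measure_fiber_le_exp_mul_le_Hpart {I : Type*} [Countable I] (b : X → I) (L : ℝ) :
    ρ {x | ρ (b ⁻¹' {b x}) ≤ ENNReal.ofReal (Real.exp (-L))} * ENNReal.ofReal L ≤ Hpart ρ b := by
  set U := {x | ρ (b ⁻¹' {b x}) ≤ ENNReal.ofReal (Real.exp (-L))} with hU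
  have hcov : U ⊆ ⋃ i, b ⁻¹' {i} ∩ U := fun x hx => mem_iUnion.2 ⟨b x, rfl, hx⟩
  calc ρ U * ENNReal.ofReal L ≤ (∑' i, ρ (b ⁻¹' {i} ∩ U)) * ENNReal.ofReal L := by
        gcongr
        exact (measure_mono hcov).trans (measure_iUnion_le _)
    _ = ∑' i, ρ (b ⁻¹' {i} ∩ U) * ENNReal.ofReal L := ENNReal.tsum_mul_right.symm
    _ ≤ Hpart ρ b := by
        refine ENNReal.tsum_le_tsum fun i => ?_
        by_cases hi : (b ⁻¹' {i} ∩ U).Nonempty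
        · obtain ⟨x, rfl, hx⟩ := hi
          set t := (ρ (b ⁻¹' {b x})).toReal with ht
          have hρ : ρ (b ⁻¹' {b x}) = ENNReal.ofReal t :=
            (ENNReal.ofReal_toReal (measure_ne_top _ _)).symm
          have ht0 : 0 ≤ t := ENNReal.toReal_nonneg
          have htL : t ≤ Real.exp (-L) := by
            rw [hU, mem_ofPred_eq, hρ] at hx
            exact (ENNReal.ofReal_le_ofReal_iff (Real.exp_pos _).le).1 hx
          calc ρ (b ⁻¹' {b x} ∩ U) * ENNReal.ofReal L
              ≤ ENNReal.ofReal t * ENNReal.ofReal L := by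
                rw [← hρ]
                gcongr
                exact inter_subset_left
            _ = ENNReal.ofReal (t * L) := (ENNReal.ofReal_mul ht0).symm
            _ ≤ ENNReal.ofReal (Real.negMulLog t) := by
                refine ENNReal.ofReal_le_ofReal ?_
                rcases ht0.eq_or_lt with h0 | h0
                · simp [← h0]
                · have := (Real.log_le_iff_le_exp h0).2 htL
                  rw [Real.negMulLog]
                  nlinarith
        · rw [not_nonempty_iff_eq_empty.1 hi, measure_empty, zero_mul]
          exact zero_le

/-- If a refining sequence of countable partitions has bounded entropy along a subsequence, then
almost every point lies in an atom of positive measure of the generated σ-algebra. -/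
theorem ae_measure_iInter_fiber_pos {I : ℕ → Type*} [∀ n, Countable (I n)] (b : ∀ n, X → I n)
    (hb : ∀ n i, MeasurableSet (b n ⁻¹' {i}))
    (hanti : ∀ x, Antitone fun n => b n ⁻¹' {b n x}) {M : ℝ≥0∞} (hM : M ≠ ∞)
    (hfreq : ∃ᶠ n in atTop, Hpart ρ (b n) ≤ M) :
    ∀ᵐ x ∂ρ, ρ (⋂ n, b n ⁻¹' {b n x}) ≠ 0 := by
  rw [ae_iff]
  simp only [not_not]
  set Z := {x | ρ (⋂ n, b n ⁻¹' {b n x}) = 0} with hZ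
  have hbound : ∀ k : ℕ, ρ Z * k ≤ M := by
    intro k
    let U : ℕ → Set X := fun n =>
      {x | ρ (b n ⁻¹' {b n x}) ≤ ENNReal.ofReal (Real.exp (-(k : ℝ)))}
    have hU : Monotone U := fun n n' hn x hx => (measure_mono (hanti x hn)).trans hx
    have hZU : Z ⊆ ⋃ n, U n := by
      intro x hx
      have hlim := tendsto_measure_iInter_atTop (fun n => (hb n (b n x)).nullMeasurableSet (μ := ρ))
        (hanti x) ⟨0, measure_ne_top _ _⟩
      rw [show ρ (⋂ n, b n ⁻¹' {b n x}) = 0 from hx] at hlim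
      have hpos : 0 < ENNReal.ofReal (Real.exp (-(k : ℝ))) :=
        ENNReal.ofReal_pos.2 (Real.exp_pos _)
      obtain ⟨n, hn⟩ := (hlim.eventually_lt_const hpos).exists
      exact mem_iUnion.2 ⟨n, hn.le⟩
    calc ρ Z * k ≤ (⨆ n, ρ (U n)) * k := by
          rw [← hU.measure_iUnion]
          gcongr
      _ = ⨆ n, ρ (U n) * k := ENNReal.iSup_mul _ _
      _ ≤ M := by
          refine iSup_le fun n => ?_
          obtain ⟨n', hn', hHn⟩ := (frequently_atTop.1 hfreq) n
          have := measure_fiber_le_exp_mul_le_Hpart (ρ := ρ) (b n') k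
          rw [ENNReal.ofReal_natCast] at this
          calc ρ (U n) * k ≤ ρ (U n') * k := by
                gcongr
                exact hU hn'
            _ ≤ M := this.trans hHn
  by_contra hne
  obtain ⟨k, hk⟩ := ENNReal.exists_nat_mul_gt hne hM
  rw [mul_comm] at hk
  exact absurd (hbound k) (not_le.2 hk)

end Atoms

section Disintegration

variable {X Y : Type*} {m : MeasurableSpace X} [mX : MeasurableSpace X] [mY : MeasurableSpace Y]
  {μ : Measure X} [IsProbabilityMeasure μ] {ν : Measure Y} [IsProbabilityMeasure ν]
  {π : X → Y} {μy : Y → Measure X}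

theorem ae_isProbabilityMeasure_of_disintegration
    (hmeas : ∀ B : Set X, MeasurableSet B → Measurable fun y => μy y B)
    (hfiber : ∀ᵐ y ∂ν, μy y (π ⁻¹' {y}) = 1)
    (hdis : ∀ B : Set X, MeasurableSet B → μ B = ∫⁻ y, μy y B ∂ν) :
    ∀ᵐ y ∂ν, IsProbabilityMeasure (μy y) := by
  have hle : (fun _ => 1) ≤ᵐ[ν] fun y => μy y univ := by
    filter_upwards [hfiber] with y hy
    exact hy ▸ measure_mono (subset_univ _)
  have heq := ae_eq_of_ae_le_of_lintegral_le hle (by simp)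
    (hmeas univ MeasurableSet.univ).aemeasurable (by
      rw [← hdis univ MeasurableSet.univ]
      simp)
  filter_upwards [heq] with y hy
  exact ⟨hy.symm⟩

theorem measurable_Hpart_disintegration
    (hmeas : ∀ B : Set X, MeasurableSet B → Measurable fun y => μy y B)
    {I : Type*} [Countable I] {b : X → I} (hb : ∀ i, MeasurableSet (b ⁻¹' {i})) :
    Measurable fun y => Hpart (μy y) b :=
  Measurable.tsum fun i => (Real.continuous_negMulLog.measurable.comp
    (hmeas _ (hb i)).ennreal_toReal).ennreal_ofReal

variable [StandardBorelSpace Y]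

theorem setLIntegral_disintegration (hπ : Measurable π)
    (hmeas : ∀ B : Set X, MeasurableSet B → Measurable fun y => μy y B)
    (hfiber : ∀ᵐ y ∂ν, μy y (π ⁻¹' {y}) = 1)
    (hdis : ∀ B : Set X, MeasurableSet B → μ B = ∫⁻ y, μy y B ∂ν)
    {B : Set X} (hB : MeasurableSet B) {C : Set Y} (hC : MeasurableSet C) :
    ∫⁻ y in C, μy y B ∂ν = μ (π ⁻¹' C ∩ B) := by
  rw [hdis _ ((hπ hC).inter hB), ← lintegral_indicator hC]
  refine lintegral_congr_ae ?_
  filter_upwards [hfiber, ae_isProbabilityMeasure_of_disintegration hmeas hfiber hdis]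
    with y hy hprob
  have hnull : μy y (π ⁻¹' {y})ᶜ = 0 :=
    (prob_compl_eq_zero_iff (hπ (MeasurableSet.singleton y))).2 hy
  by_cases hyC : y ∈ C
  · rw [indicator_of_mem hyC]
    refine measure_congr (ae_iff.2 (measure_mono_null ?_ hnull))
    intro x hx hxy
    refine hx (propext ⟨fun h => ⟨?_, h⟩, fun h => h.2⟩)
    rw [mem_preimage, show π x = y from hxy]
    exact hyC
  · rw [indicator_of_notMem hyC]
    refine (measure_mono_null ?_ hnull).symm
    rintro x ⟨hxC, -⟩ hxy
    exact hyC ((show π x = y from hxy) ▸ hxC)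

variable [StandardBorelSpace X]

theorem disintegration_ae_eq_condExp (hm : m ≤ mX) (hπ : Measurable π)
    (hmap : Measure.map π μ = ν)
    (hm1 : ∀ A : Set X, MeasurableSet[m] A →
      ∃ B : Set Y, MeasurableSet B ∧ μ (A ∆ (π ⁻¹' B)) = 0)
    (hm2 : ∀ B : Set Y, MeasurableSet B →
      ∃ A : Set X, MeasurableSet[m] A ∧ μ ((π ⁻¹' B) ∆ A) = 0)
    (hmeas : ∀ B : Set X, MeasurableSet B → Measurable fun y => μy y B)
    (hfiber : ∀ᵐ y ∂ν, μy y (π ⁻¹' {y}) = 1)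
    (hdis : ∀ B : Set X, MeasurableSet B → μ B = ∫⁻ y, μy y B ∂ν)
    {B : Set X} (hB : MeasurableSet B) :
    (fun x => (μy (π x) B).toReal) =ᵐ[μ] μ[B.indicator (fun _ => (1 : ℝ)) | m] := by
  have hsup : m ⊔ mY.comap π ≤ mX := sup_le hm hπ.comap_le
  have hsupev : m ⊔ mY.comap π ≤ eventuallyMeasurableSpace m (ae μ) := by
    refine sup_le le_eventuallyMeasurableSpace ?_
    rintro _ ⟨C, hC, rfl⟩
    obtain ⟨A, hA, hCA⟩ := hm2 C hC
    exact ⟨A, hA, measure_symmDiff_eq_zero_iff.1 hCA⟩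
  have hκ : Measurable[m] fun x => ProbabilityTheory.condExpKernel μ m x B :=
    ProbabilityTheory.measurable_condExpKernel hB
  have hπsup : Measurable[m ⊔ mY.comap π] π :=
    (comap_measurable π).mono le_sup_right le_rfl
  have h₁ := toReal_ae_eq_condExp_indicator (μ := μ) hm hB hκ
    fun A hA => setLIntegral_condExpKernel hm hA hB
  have h₂ := toReal_ae_eq_condExp_indicator (μ := μ) hsup hB (hκ.mono le_sup_left le_rfl) <| by
    intro A hA
    obtain ⟨A', hA', hAA'⟩ := hsupev A hA
    rw [setLIntegral_congr hAA', setLIntegral_condExpKernel hm hA' hB]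
    exact measure_congr (hAA'.symm.inter (ae_eq_refl B))
  have h₃ := toReal_ae_eq_condExp_indicator (μ := μ) hsup hB ((hmeas B hB).comp hπsup) <| by
    intro A hA
    obtain ⟨A', hA', hAA'⟩ := hsupev A hA
    obtain ⟨C, hC, hAC⟩ := hm1 A' hA'
    have hAC' : A =ᵐ[μ] π ⁻¹' C := hAA'.trans (measure_symmDiff_eq_zero_iff.1 hAC)
    have h_integral := setLIntegral_disintegration hπ hmeas hfiber hdis hB hC
    rw [← hmap, setLIntegral_map hC (hmeas B hB) hπ] at h_integral
    rw [setLIntegral_congr hAC']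
    exact h_integral.trans (measure_congr (hAC'.symm.inter (ae_eq_refl B)))
  exact h₃.trans (h₂.symm.trans h₁)

/-- If a refining sequence of partitions has bounded conditional entropy, then almost surely the
conditional measures charge the atoms of the limit partition. -/
theorem ae_ae_measure_iInter_fiber_pos (hm : m ≤ mX) (hπ : Measurable π)
    (hmap : Measure.map π μ = ν)
    (hm1 : ∀ A : Set X, MeasurableSet[m] A →
      ∃ B : Set Y, MeasurableSet B ∧ μ (A ∆ (π ⁻¹' B)) = 0)
    (hm2 : ∀ B : Set Y, MeasurableSet B →
      ∃ A : Set X, MeasurableSet[m] A ∧ μ ((π ⁻¹' B) ∆ A) = 0)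
    (hmeas : ∀ B : Set X, MeasurableSet B → Measurable fun y => μy y B)
    (hfiber : ∀ᵐ y ∂ν, μy y (π ⁻¹' {y}) = 1)
    (hdis : ∀ B : Set X, MeasurableSet B → μ B = ∫⁻ y, μy y B ∂ν)
    {I : ℕ → Type*} [∀ n, Countable (I n)] (b : ∀ n, X → I n)
    (hb : ∀ n i, MeasurableSet (b n ⁻¹' {i}))
    (hanti : ∀ x, Antitone fun n => b n ⁻¹' {b n x}) {M : ℝ≥0∞} (hM : M ≠ ∞)
    (hbound : ∀ n, condEntS m μ (b n) ≤ M) :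
    ∀ᵐ y ∂ν, ∀ᵐ x ∂(μy y), μy y (⋂ n, b n ⁻¹' {b n x}) ≠ 0 := by
  have h_integral : ∀ n, ∫⁻ y, Hpart (μy y) (b n) ∂ν ≤ M := by
    intro n
    rw [← hmap, lintegral_map (measurable_Hpart_disintegration hmeas (hb n)) hπ,
      ← condEntS_eq_lintegral_Hpart (m := m) (κ := fun x => μy (π x)) (b n) fun i =>
        disintegration_ae_eq_condExp hm hπ hmap hm1 hm2 hmeas hfiber hdis (hb n i)]
    exact hbound n
  have hH : ∀ n, Measurable fun y => Hpart (μy y) (b n) :=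
    fun n => measurable_Hpart_disintegration hmeas (hb n)
  have hliminf : ∫⁻ y, liminf (fun n => Hpart (μy y) (b n)) atTop ∂ν ≤ M :=
    (lintegral_liminf_le hH).trans <|
      (liminf_le_liminf (Eventually.of_forall h_integral)).trans (by simp)
  filter_upwards [ae_lt_top (Measurable.liminf hH) (hliminf.trans_lt hM.lt_top).ne,
    ae_isProbabilityMeasure_of_disintegration hmeas hfiber hdis] with y hy hprob
  obtain ⟨M', hyM', hM'⟩ := exists_between hy
  exact ae_measure_iInter_fiber_pos b hb hanti hM'.ne
    ((frequently_lt_of_liminf_lt (by isBoundedDefault) hyM').mono fun n hn => hn.le)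

end Disintegration

section Generating

variable {G X : Type*} [Group G] [mX : MeasurableSpace X]
  {T : BorelAction G X} {a : X → ℕ}

theorem mem_iff_mem_of_measurableSet_partSA {F : Set G} {A : Set X}
    (hA : MeasurableSet[T.partSA F a] A) {x z : X}
    (hxz : ∀ g ∈ F, a (T.act g⁻¹ z) = a (T.act g⁻¹ x)) : z ∈ A ↔ x ∈ A := by
  have hle : T.partSA F a ≤ MeasurableSpace.comap (T.joinF F a) ⊤ := by
    refine iSup₂_le fun g hg => ?_
    rintro _ ⟨s, -, rfl⟩
    exact ⟨(fun v => v ⟨g, hg⟩) ⁻¹' s, trivial, rfl⟩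
  obtain ⟨s, -, rfl⟩ := hle A hA
  have : T.joinF F a z = T.joinF F a x := funext fun g => hxz g g.2
  rw [mem_preimage, mem_preimage, this]

/-- A generating partition separates points off a null set. -/
theorem BorelAction.Generating.exists_null_separating [StandardBorelSpace X] {μ : Measure X}
    (hgen : T.Generating a μ) (ha : Measurable a) :
    ∃ N : Set X, MeasurableSet N ∧ μ N = 0 ∧ ∀ x ∉ N, ∀ z ∉ N,
      (∀ g : G, a (T.act g⁻¹ z) = a (T.act g⁻¹ x)) → z = x := by
  obtain ⟨V, hV, hsep⟩ := exists_seq_separating X MeasurableSet.univ univ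
  choose V' hV' hVV' using fun k => hgen (V k) (hV k)
  refine ⟨⋃ k, V k ∆ V' k,
    MeasurableSet.iUnion fun k => (hV k).symmDiff (partSA_le ha univ _ (hV' k)),
    measure_iUnion_null hVV', fun x hx z hz hxz => ?_⟩
  have hmem : ∀ w ∉ ⋃ k, V k ∆ V' k, ∀ k, w ∈ V k ↔ w ∈ V' k := by
    intro w hw k
    have := mt (fun h => mem_iUnion.2 ⟨k, h⟩) hw
    rw [mem_symmDiff] at this
    tauto
  refine hsep z trivial x trivial fun k => ?_
  rw [hmem z hz k, hmem x hx k]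
  exact mem_iff_mem_of_measurableSet_partSA (hV' k) fun g _ => hxz g

end Generating

section Unbounded

variable {r : ℕ} {X Y : Type*} {m : MeasurableSpace X} [mX : MeasurableSpace X]
  [StandardBorelSpace X] [mY : MeasurableSpace Y] [StandardBorelSpace Y]
  {μ : Measure X} [IsProbabilityMeasure μ] {ν : Measure Y} [IsProbabilityMeasure ν]
  {T : BorelAction (FG r) X} {a : X → ℕ} {π : X → Y} {μy : Y → Measure X}

/-- If the conditional entropies of a generating partition along balls are bounded, then almost
all conditional measures are purely atomic. -/
theorem ae_purelyAtomic_of_condEntS_ball_le (hm : m ≤ mX) (ha : Measurable a)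
    (hgen : T.Generating a μ) (hπ : Measurable π) (hmap : Measure.map π μ = ν)
    (hm1 : ∀ A : Set X, MeasurableSet[m] A →
      ∃ B : Set Y, MeasurableSet B ∧ μ (A ∆ (π ⁻¹' B)) = 0)
    (hm2 : ∀ B : Set Y, MeasurableSet B →
      ∃ A : Set X, MeasurableSet[m] A ∧ μ ((π ⁻¹' B) ∆ A) = 0)
    (hmeas : ∀ B : Set X, MeasurableSet B → Measurable fun y => μy y B)
    (hfiber : ∀ᵐ y ∂ν, μy y (π ⁻¹' {y}) = 1)
    (hdis : ∀ B : Set X, MeasurableSet B → μ B = ∫⁻ y, μy y B ∂ν)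
    {M : ℝ≥0∞} (hM : M ≠ ∞) (hbound : ∀ n, condEntS m μ (T.joinF (ball r n) a) ≤ M) :
    ∀ᵐ y ∂ν, PurelyAtomic (μy y) := by
  obtain ⟨N, hN, hμN, hsep⟩ := hgen.exists_null_separating ha
  have hfib : ∀ n x z, z ∈ T.joinF (ball r n) a ⁻¹' {T.joinF (ball r n) a x} ↔
      ∀ g : FG r, wlen g ≤ n → a (T.act g⁻¹ z) = a (T.act g⁻¹ x) := by
    intro n x z
    rw [mem_preimage, mem_singleton_iff, funext_iff, Subtype.forall]
    rfl
  have hanti : ∀ x, Antitone fun n => T.joinF (ball r n) a ⁻¹' {T.joinF (ball r n) a x} := by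
    intro x n k hnk z hz
    rw [hfib] at hz ⊢
    exact fun g hg => hz g (hg.trans hnk)
  have hatoms := ae_ae_measure_iInter_fiber_pos hm hπ hmap hm1 hm2 hmeas hfiber hdis
    (fun n => T.joinF (ball r n) a) (fun n => measurableSet_joinF_fiber ha (ball r n)) hanti hM
    hbound
  have hyN : ∀ᵐ y ∂ν, μy y N = 0 := by
    rw [hdis N hN, lintegral_eq_zero_iff (hmeas N hN)] at hμN
    exact hμN
  filter_upwards [hatoms, hyN, ae_isProbabilityMeasure_of_disintegration hmeas hfiber hdis]
    with y hy hyN hprob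
  have hpos : ∀ᵐ x ∂(μy y), 0 < μy y {x} := by
    filter_upwards [hy, measure_eq_zero_iff_ae_notMem.1 hyN] with x hx hxN
    refine pos_iff_ne_zero.2 fun h0 => hx (measure_mono_null ?_ (measure_union_null h0 hyN))
    intro z hz
    by_cases hzN : z ∈ N
    · exact Or.inr hzN
    · refine Or.inl (hsep x hxN z hzN fun g => ?_)
      exact (hfib (wlen g) x z).1 (mem_iInter.1 hz (wlen g)) g le_rfl
  rw [PurelyAtomic, measure_congr (eventuallyEq_univ.2 hpos), measure_univ]

end Unbounded

/-- Exponential growth rate `2r − 1` of the successive conditional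
entropies for actions with finite relative f-invariant entropy over a factor with
non-atomic fibers. -/
theorem statement9 {r : ℕ} (hr : 1 < r) {X Y : Type*}
    (m : MeasurableSpace X) [mX : MeasurableSpace X] [StandardBorelSpace X]
    [mY : MeasurableSpace Y] [StandardBorelSpace Y]
    (μ : Measure X) [IsProbabilityMeasure μ]
    (ν : Measure Y) [IsProbabilityMeasure ν]
    (T : BorelAction (FG r) X) (hT : T.Preserves μ)
    (hm : InvariantSA m T)
    (a : X → ℕ) (ha : Measurable a) (hgen : T.Generating a μ) (hent : Hpart μ a < ⊤)
    (π : X → Y) (hπ : Measurable π) (hmap : Measure.map π μ = ν)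
    (hm1 : ∀ A : Set X, MeasurableSet[m] A →
      ∃ B : Set Y, MeasurableSet B ∧ μ (A ∆ (π ⁻¹' B)) = 0)
    (hm2 : ∀ B : Set Y, MeasurableSet B →
      ∃ A : Set X, MeasurableSet[m] A ∧ μ ((π ⁻¹' B) ∆ A) = 0)
    (μy : Y → Measure X)
    (hmeas : ∀ B : Set X, MeasurableSet B → Measurable fun y => μy y B)
    (hfiber : ∀ᵐ y ∂ν, μy y (π ⁻¹' {y}) = 1)
    (hdis : ∀ B : Set X, MeasurableSet B → μ B = ∫⁻ y, μy y B ∂ν)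
    (hfin : fInvRel m μ T a ≠ ⊥)
    (hna : 0 < ν {y | ¬ PurelyAtomic (μy y)}) :
    Filter.Tendsto (fun n : ℕ =>
        ((condEntS (m ⊔ T.partSA (ball r n) a) μ (T.joinF (ball r (n + 1)) a)).toReal)
          ^ ((n : ℝ)⁻¹))
      Filter.atTop (nhds (2 * (r : ℝ) - 1)) := by
  have hfinite : ∀ F : Finset (FG r), condEntS m μ (T.joinF (F : Set (FG r)) a) ≠ ∞ :=
    fun F => (condEntS_joinF_lt_top hT hm ha hent F).ne
  set h : Finset (FG r) → ℝ := fun F => (condEntS m μ (T.joinF (F : Set (FG r)) a)).toReal with hh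
  have hball : ∀ n, condEntS m μ (T.joinF (ball r n) a) =
      condEntS m μ (T.joinF (ballFinset r n : Set (FG r)) a) :=
    fun n => condEntS_joinF_congr (coe_ballFinset n).symm
  have hsub : ∀ F K, h (F ∪ K) + h (F ∩ K) ≤ h F + h K := by
    intro F K
    simp only [hh]
    rw [← ENNReal.toReal_add (hfinite _) (hfinite _), ← ENNReal.toReal_add (hfinite _) (hfinite _)]
    refine ENNReal.toReal_mono (ENNReal.add_ne_top.2 ⟨hfinite _, hfinite _⟩) ?_
    rw [condEntS_joinF_congr (Finset.coe_union F K), condEntS_joinF_congr (Finset.coe_inter F K)]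
    exact condEntS_joinF_submodular hm.1 ha _ _
  have hmono : ∀ F K, F ⊆ K → h F ≤ h K := fun F K hFK =>
    ENNReal.toReal_mono (hfinite K) (condEntS_joinF_mono hm.1 ha (Finset.coe_subset.2 hFK))
  have hcoe : ∀ (F : Finset (FG r)) (g : FG r),
      (leftTranslate g F : Set (FG r)) = (fun k => g * k) '' (F : Set (FG r)) :=
    fun F g => Finset.coe_image
  have hinv : ∀ F g, h (leftTranslate g F) = h F := by
    intro F g
    simp only [hh]
    rw [condEntS_joinF_congr (hcoe F g), condEntS_joinF_image_mul hT hm ha]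
  have hF : ∀ n, fSeqRel m μ T a n = (1 - 2 * (r : ℝ)) * h (ballFinset r n) +
      ∑ i : Fin r, h (ballFinset r n ∪ leftTranslate (FreeGroup.of i) (ballFinset r n)) := by
    intro n
    rw [fSeqRel, FFrel, hball]
    congr 1
    refine Finset.sum_congr rfl fun i _ => ?_
    rw [condEntS_tr_joinF_prodMk]
    refine congrArg ENNReal.toReal (condEntS_joinF_congr ?_)
    rw [Finset.coe_union, hcoe, coe_ballFinset]
  obtain ⟨c, hc⟩ : ∃ c : ℝ, ∀ n, c ≤ fSeqRel m μ T a n := by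
    have hle : ∀ n, fInvRel m μ T a ≤ (fSeqRel m μ T a n : EReal) := fun n => iInf_le _ n
    have htop : fInvRel m μ T a ≠ ⊤ := ne_top_of_le_ne_top (EReal.coe_ne_top _) (hle 0)
    refine ⟨(fInvRel m μ T a).toReal, fun n => EReal.coe_le_coe_iff.1 ?_⟩
    rw [EReal.coe_toReal htop hfin]
    exact hle n
  have hunb : ∀ M, ∃ n, M < h (ballFinset r n) := by
    by_contra! hcon
    obtain ⟨M, hM⟩ := hcon
    refine hna.ne' (ae_purelyAtomic_of_condEntS_ball_le hm.1 ha hgen hπ hmap hm1 hm2 hmeas hfiber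
      hdis (M := ENNReal.ofReal M) ENNReal.ofReal_ne_top fun n => ?_)
    rw [hball]
    exact ENNReal.le_ofReal_iff_toReal_le (hfinite _) (ENNReal.toReal_nonneg.trans (hM n))
      |>.2 (hM n)
  refine (tendsto_increment_ballFinset hr hsub hmono hinv (fun n => (hc n).trans_eq (hF n))
    hunb).congr fun n => ?_
  have hle : ball r n ⊆ ball r (n + 1) := fun g hg => Nat.le_succ_of_le hg
  have hchain := condEntS_joinF_of_subset (μ := μ) (T := T) hm.1 ha hle
  rw [hball, hball] at hchain
  have hne := hchain ▸ hfinite (ballFinset r (n + 1))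
  rw [sub_eq_of_eq_add']
  simp only [hh]
  rw [hchain, ENNReal.toReal_add (hfinite _) (ENNReal.add_ne_top.1 hne).2]

end FPaper
end

section
/- Let G be a free group of finite rank r > 1 with free generating set S, acting on a standard Borel probability space (X, μ) by μ-preserving Borel automorphisms, and let K be a non-trivial normal subgroup of G such that k·x = x for every k ∈ K and x ∈ X (the action factors through G/K). If f_G(X, μ) is defined and μ is not purely atomic, then f_G(X, μ) = −∞. -/
open MeasureTheory Filter Set
open scoped ENNReal symmDiff Pointwise

namespace FPaper

/-! ### Shannon entropy of countable partitions -/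

section Entropy

variable {X : Type*} [MeasurableSpace X] {μ : Measure X}

section Basic

variable {I J L : Type*} [MeasurableSpace I] [MeasurableSingletonClass I] [Countable I]
  [MeasurableSpace J] [MeasurableSingletonClass J] [Countable J]
  [MeasurableSpace L] [MeasurableSingletonClass L]

lemma lintegral_comp_eq_tsum {b : X → I} (hb : Measurable b) (f : I → ℝ≥0∞) :
    ∫⁻ x, f (b x) ∂μ = ∑' i, f i * μ (b ⁻¹' {i}) := by
  rw [← lintegral_map (measurable_of_countable f) hb, lintegral_countable']
  exact tsum_congr fun i => by rw [Measure.map_apply hb (measurableSet_singleton i)]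

lemma ae_measure_fiber_pos {b : X → I} (hb : Measurable b) :
    ∀ᵐ x ∂μ, 0 < μ (b ⁻¹' {b x}) := by
  have : ∫⁻ x, (fun i => if μ (b ⁻¹' {i}) = 0 then (1 : ℝ≥0∞) else 0) (b x) ∂μ = 0 := by
    rw [lintegral_comp_eq_tsum hb fun i => if μ (b ⁻¹' {i}) = 0 then (1 : ℝ≥0∞) else 0]
    simp
  replace this := (lintegral_eq_zero_iff ((measurable_of_countable
    fun i => if μ (b ⁻¹' {i}) = 0 then (1 : ℝ≥0∞) else 0).comp hb)).1 this
  filter_upwards [this] with x hx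
  rw [pos_iff_ne_zero]
  intro h0
  simp [h0] at hx

lemma measurable_ofReal_neg_log_measure_fiber {b : X → I} (hb : Measurable b) :
    Measurable fun x => ENNReal.ofReal (-Real.log (μ (b ⁻¹' {b x})).toReal) :=
  (measurable_of_countable
    fun i => ENNReal.ofReal (-Real.log (μ (b ⁻¹' {i})).toReal)).comp hb

lemma tsum_measure_fiber_prod {a : X → I} {c : X → L} (ha : Measurable a) (hc : Measurable c)
    (k : L) : ∑' i, μ ((fun x => (a x, c x)) ⁻¹' {(i, k)}) = μ (c ⁻¹' {k}) := by
  have hpre : ∀ i, (fun x => (a x, c x)) ⁻¹' {(i, k)} = a ⁻¹' {i} ∩ c ⁻¹' {k} := fun i => by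
    ext x
    simp
  simp_rw [hpre]
  rw [← measure_iUnion]
  · rw [← Set.iUnion_inter, ← Set.preimage_iUnion, Set.iUnion_of_singleton, Set.preimage_univ,
      Set.univ_inter]
  · intro i j hij
    refine Set.disjoint_left.2 fun x hx hx' => hij ?_
    rw [← (hx.1 : a x = i), ← (hx'.1 : a x = j)]
  · exact fun i => (ha (measurableSet_singleton i)).inter (hc (measurableSet_singleton k))

variable [Countable L] [IsProbabilityMeasure μ]

lemma Hpart_eq_lintegral {b : X → I} (hb : Measurable b) :
    Hpart μ b = ∫⁻ x, ENNReal.ofReal (-Real.log (μ (b ⁻¹' {b x})).toReal) ∂μ := by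
  rw [lintegral_comp_eq_tsum hb fun i => ENNReal.ofReal (-Real.log (μ (b ⁻¹' {i})).toReal)]
  refine tsum_congr fun i => ?_
  rw [Real.negMulLog, neg_mul, ← mul_neg, ENNReal.ofReal_mul ENNReal.toReal_nonneg,
    ENNReal.ofReal_toReal (measure_ne_top _ _), mul_comm]

lemma Hpart_congr {b : X → I} {c : X → J} (hb : Measurable b) (hc : Measurable c)
    (hbc : ∀ x y, b x = b y ↔ c x = c y) : Hpart μ b = Hpart μ c := by
  rw [Hpart_eq_lintegral hb, Hpart_eq_lintegral hc]
  have : ∀ x, b ⁻¹' {b x} = c ⁻¹' {c x} := fun x => by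
    ext y
    exact hbc y x
  simp_rw [this]

lemma Hpart_mono {b : X → I} {c : X → J} (hb : Measurable b) (hc : Measurable c)
    (hbc : ∀ x y, c x = c y → b x = b y) : Hpart μ b ≤ Hpart μ c := by
  rw [Hpart_eq_lintegral hb, Hpart_eq_lintegral hc]
  refine lintegral_mono_ae ?_
  filter_upwards [ae_measure_fiber_pos (μ := μ) hc] with x hx
  refine ENNReal.ofReal_le_ofReal (neg_le_neg (Real.log_le_log ?_ ?_))
  · exact ENNReal.toReal_pos hx.ne' (measure_ne_top _ _)
  · exact ENNReal.toReal_mono (measure_ne_top _ _) (measure_mono fun y hy => hbc y x hy)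

/-- The density ratio whose logarithm integrates to the conditional mutual information. -/
noncomputable def condRatio (μ : Measure X) (a : X → I) (b : X → J) (c : X → L)
    (q : I × J × L) : ℝ≥0∞ :=
  μ ((fun x => (a x, c x)) ⁻¹' {(q.1, q.2.2)}) * μ ((fun x => (b x, c x)) ⁻¹' {(q.2.1, q.2.2)})
    / (μ ((fun x => (a x, b x, c x)) ⁻¹' {q}) * μ (c ⁻¹' {q.2.2}))

lemma lintegral_condRatio_le {a : X → I} {b : X → J} {c : X → L}
    (ha : Measurable a) (hb : Measurable b) (hc : Measurable c) :
    ∫⁻ x, condRatio μ a b c (a x, b x, c x) ∂μ ≤ 1 := by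
  rw [lintegral_comp_eq_tsum (ha.prodMk (hb.prodMk hc)) (condRatio μ a b c)]
  have hle : ∀ q : I × J × L,
      condRatio μ a b c q * μ ((fun x => (a x, b x, c x)) ⁻¹' {q}) ≤
      μ ((fun x => (a x, c x)) ⁻¹' {(q.1, q.2.2)})
        * (μ ((fun x => (b x, c x)) ⁻¹' {(q.2.1, q.2.2)}) * (μ (c ⁻¹' {q.2.2}))⁻¹) := by
    intro q
    rcases eq_or_ne (μ ((fun x => (a x, b x, c x)) ⁻¹' {q})) 0 with h0 | h0
    · rw [h0, mul_zero]
      exact bot_le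
    · have hfin := measure_ne_top μ ((fun x => (a x, b x, c x)) ⁻¹' {q})
      rw [condRatio, div_eq_mul_inv, ENNReal.mul_inv (Or.inl h0) (Or.inl hfin)]
      refine le_of_eq ?_
      calc _ = μ ((fun x => (a x, c x)) ⁻¹' {(q.1, q.2.2)})
          * (μ ((fun x => (b x, c x)) ⁻¹' {(q.2.1, q.2.2)}) * (μ (c ⁻¹' {q.2.2}))⁻¹)
          * ((μ ((fun x => (a x, b x, c x)) ⁻¹' {q}))⁻¹
            * μ ((fun x => (a x, b x, c x)) ⁻¹' {q})) := by ring
        _ = _ := by rw [ENNReal.inv_mul_cancel h0 hfin, mul_one]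
  refine (ENNReal.tsum_le_tsum hle).trans ?_
  rw [ENNReal.tsum_prod', ENNReal.tsum_comm, ENNReal.tsum_prod', ENNReal.tsum_comm]
  simp only [ENNReal.tsum_mul_right, ENNReal.tsum_mul_left]
  simp only [tsum_measure_fiber_prod ha hc, tsum_measure_fiber_prod hb hc]
  calc _ ≤ ∑' k, μ (c ⁻¹' {k}) := by
        refine ENNReal.tsum_le_tsum fun k => ?_
        calc _ ≤ μ (c ⁻¹' {k}) * 1 := by
              gcongr
              exact ENNReal.mul_inv_le_one _
          _ = _ := mul_one _
    _ = ∫⁻ _, 1 ∂μ := by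
        rw [lintegral_comp_eq_tsum hc fun _ => 1]
        simp
    _ = 1 := by simp

/-- Submodularity of Shannon entropy. -/
lemma Hpart_submodular {a : X → I} {b : X → J} {c : X → L}
    (ha : Measurable a) (hb : Measurable b) (hc : Measurable c) :
    Hpart μ (fun x => (a x, b x, c x)) + Hpart μ c
      ≤ Hpart μ (fun x => (a x, c x)) + Hpart μ (fun x => (b x, c x)) := by
  have habc := ha.prodMk (hb.prodMk hc)
  have hac := ha.prodMk hc
  have hbc := hb.prodMk hc
  have mabc := measurable_ofReal_neg_log_measure_fiber (μ := μ) habc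
  have mac := measurable_ofReal_neg_log_measure_fiber (μ := μ) hac
  have mbc := measurable_ofReal_neg_log_measure_fiber (μ := μ) hbc
  have mc := measurable_ofReal_neg_log_measure_fiber (μ := μ) hc
  have hlog : ∀ s : Set X, 0 ≤ -Real.log (μ s).toReal := fun s => by
    rw [neg_nonneg]
    exact Real.log_nonpos ENNReal.toReal_nonneg
      (by simpa using ENNReal.toReal_mono ENNReal.one_ne_top (prob_le_one (μ := μ) (s := s)))
  have key : Hpart μ (fun x => (a x, b x, c x)) + Hpart μ c + 1
      ≤ Hpart μ (fun x => (a x, c x)) + Hpart μ (fun x => (b x, c x)) + 1 := by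
    refine le_trans ?_ (add_le_add_right (lintegral_condRatio_le (μ := μ) ha hb hc) _)
    have hone : (1 : ℝ≥0∞) = ∫⁻ _, 1 ∂μ := by simp
    rw [Hpart_eq_lintegral habc, Hpart_eq_lintegral hac, Hpart_eq_lintegral hbc,
      Hpart_eq_lintegral hc, hone, ← lintegral_add_left mabc,
      ← lintegral_add_left (mabc.fun_add mc), ← lintegral_add_left mac,
      ← lintegral_add_left (mac.fun_add mbc)]
    refine lintegral_mono_ae ?_
    filter_upwards [ae_measure_fiber_pos (μ := μ) habc, ae_measure_fiber_pos (μ := μ) hac,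
      ae_measure_fiber_pos (μ := μ) hbc, ae_measure_fiber_pos (μ := μ) hc] with x h1 h2 h3 h4
    have hpos : ∀ {s : Set X}, 0 < μ s → 0 < (μ s).toReal := fun hs =>
      ENNReal.toReal_pos hs.ne' (measure_ne_top _ _)
    have hratio : condRatio μ a b c (a x, b x, c x) = ENNReal.ofReal
        ((μ ((fun x => (a x, c x)) ⁻¹' {(a x, c x)})).toReal
          * (μ ((fun x => (b x, c x)) ⁻¹' {(b x, c x)})).toReal
          / ((μ ((fun x => (a x, b x, c x)) ⁻¹' {(a x, b x, c x)})).toReal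
            * (μ (c ⁻¹' {c x})).toReal)) := by
      rw [ENNReal.ofReal_div_of_pos (mul_pos (hpos h1) (hpos h4)),
        ENNReal.ofReal_mul ENNReal.toReal_nonneg, ENNReal.ofReal_mul ENNReal.toReal_nonneg]
      simp only [ENNReal.ofReal_toReal (measure_ne_top _ _)]
      rfl
    rw [hratio]
    have p1 := hpos h1
    have p2 := hpos h2
    have p3 := hpos h3
    have p4 := hpos h4
    rw [← ENNReal.ofReal_one, ← ENNReal.ofReal_add (hlog _) (hlog _),
      ← ENNReal.ofReal_add (add_nonneg (hlog _) (hlog _)) zero_le_one,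
      ← ENNReal.ofReal_add (hlog _) (hlog _),
      ← ENNReal.ofReal_add (add_nonneg (hlog _) (hlog _)) (by positivity)]
    refine ENNReal.ofReal_le_ofReal ?_
    have := Real.log_le_sub_one_of_pos (div_pos (mul_pos p2 p3) (mul_pos p1 p4))
    rw [Real.log_div (mul_pos p2 p3).ne' (mul_pos p1 p4).ne', Real.log_mul p2.ne' p3.ne',
      Real.log_mul p1.ne' p4.ne'] at this
    linarith
  exact (ENNReal.add_le_add_iff_right ENNReal.one_ne_top).1 key

end Basic

end Entropy

/-! ### Invariant submodular functions on finite subsets of a group -/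

section Submodular

variable {G : Type*} [DecidableEq G]

/-- The mutual information of two finite sets with respect to `h`. -/
def mutualInfo (h : Finset G → ℝ) (A B : Finset G) : ℝ := h A + h B - h (A ∪ B)

lemma mutualInfo_comm (h : Finset G → ℝ) (A B : Finset G) :
    mutualInfo h A B = mutualInfo h B A := by
  unfold mutualInfo
  rw [Finset.union_comm]
  ring

lemma mutualInfo_insert {h : Finset G → ℝ} {g : G} {A B : Finset G} (hg : g ∈ B) :
    mutualInfo h (insert g A) B = mutualInfo h A B + (h (insert g A) - h A) := by
  unfold mutualInfo
  rw [Finset.insert_union, Finset.insert_eq_of_mem (Finset.mem_union_right A hg)]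
  ring

variable [Group G]

/-- Monotone, submodular, left-invariant functions of finite subsets of a group. -/
structure IsInvSubmodular (h : Finset G → ℝ) : Prop where
  mono : ∀ A B, A ⊆ B → h A ≤ h B
  submod : ∀ A B, h (A ∪ B) + h (A ∩ B) ≤ h A + h B
  smul : ∀ (g : G) (A : Finset G), h (g • A) = h A

namespace IsInvSubmodular

variable {h : Finset G → ℝ}

lemma mutualInfo_mono_left (hh : IsInvSubmodular h) {A A' : Finset G} (B : Finset G)
    (hA : A ⊆ A') : mutualInfo h A B ≤ mutualInfo h A' B := by
  have h1 := hh.submod A' (A ∪ B)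
  have h2 := hh.mono A (A' ∩ (A ∪ B)) (Finset.subset_inter hA Finset.subset_union_left)
  rw [← Finset.union_assoc, Finset.union_eq_left.2 hA] at h1
  unfold mutualInfo
  linarith

lemma mutualInfo_mono (hh : IsInvSubmodular h) {A A' B B' : Finset G}
    (hA : A ⊆ A') (hB : B ⊆ B') : mutualInfo h A B ≤ mutualInfo h A' B' := by
  refine (hh.mutualInfo_mono_left B hA).trans ?_
  rw [mutualInfo_comm h A' B, mutualInfo_comm h A' B']
  exact hh.mutualInfo_mono_left A' hB

lemma mutualInfo_smul (hh : IsInvSubmodular h) (g : G) (A B : Finset G) :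
    mutualInfo h (g • A) (g • B) = mutualInfo h A B := by
  unfold mutualInfo
  rw [← Finset.smul_finset_union, hh.smul, hh.smul, hh.smul]

lemma le_mutualInfo (hh : IsInvSubmodular h) {A B C : Finset G} (hA : C ⊆ A) (hB : C ⊆ B) :
    h C ≤ mutualInfo h A B := by
  have h1 := hh.submod A B
  have h2 := hh.mono C (A ∩ B) (Finset.subset_inter hA hB)
  unfold mutualInfo
  linarith

end IsInvSubmodular

variable {V ι : Type*} [Fintype V] [Fintype ι]

/-- The analogue of the functional `F` for a family of finite sets indexed by the vertices of a
finite graph, whose edges labelled `i` join `p` to `σ i p`. -/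
def graphFun (h : Finset G → ℝ) (s : ι → G) (σ : ι → Equiv.Perm V) (W : V → Finset G) : ℝ :=
  ∑ p, h (W p) - ∑ p, ∑ i, mutualInfo h (W p) (s i • W (σ i p))

lemma graphFun_update_insert_le [DecidableEq V] {h : Finset G → ℝ} (hh : IsInvSubmodular h)
    (s : ι → G) (σ : ι → Equiv.Perm V) (W : V → Finset G) (p : V) (g : G) (i : ι)
    (hg : g ∈ s i • W (σ i p) ∨ g ∈ (s i)⁻¹ • W ((σ i).symm p)) :
    graphFun h s σ (Function.update W p (insert g (W p))) ≤ graphFun h s σ W := by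
  classical
  set W' := Function.update W p (insert g (W p)) with hW'
  set c := h (insert g (W p)) - h (W p) with hc
  have hsub : ∀ q, W q ⊆ W' q := by
    intro q
    rcases eq_or_ne q p with rfl | hq
    · simp [hW']
    · simp [hW', hq]
  have hp : W' p = insert g (W p) := by simp [hW']
  have hverts : ∑ q, h (W' q) = ∑ q, h (W q) + c := by
    have : ∀ q, h (W' q) = h (W q) + if q = p then c else 0 := by
      intro q
      rcases eq_or_ne q p with rfl | hq
      · simp [hp, hc]
      · simp [hW', hq]
    simp_rw [this, Finset.sum_add_distrib]
    simp
  have hmono : ∀ q j, mutualInfo h (W q) (s j • W (σ j q))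
      ≤ mutualInfo h (W' q) (s j • W' (σ j q)) := fun q j =>
    hh.mutualInfo_mono (hsub q) (Finset.smul_finset_subset_smul_finset (hsub _))
  obtain ⟨q₀, hq₀⟩ : ∃ q₀, mutualInfo h (W q₀) (s i • W (σ i q₀)) + c
      ≤ mutualInfo h (W' q₀) (s i • W' (σ i q₀)) := by
    rcases hg with hg | hg
    · refine ⟨p, ?_⟩
      rw [hc, ← mutualInfo_insert hg, ← hp]
      exact hh.mutualInfo_mono subset_rfl (Finset.smul_finset_subset_smul_finset (hsub _))
    · refine ⟨(σ i).symm p, ?_⟩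
      rw [Equiv.apply_symm_apply, ← hh.mutualInfo_smul (s i)⁻¹, inv_smul_smul,
        mutualInfo_comm, hc, ← mutualInfo_insert hg, ← hp, mutualInfo_comm,
        ← hh.mutualInfo_smul (s i), smul_inv_smul]
      exact hh.mutualInfo_mono (hsub _) subset_rfl
  have hedges : ∑ q, ∑ j, mutualInfo h (W q) (s j • W (σ j q)) + c
      ≤ ∑ q, ∑ j, mutualInfo h (W' q) (s j • W' (σ j q)) := by
    have : ∀ q j, mutualInfo h (W q) (s j • W (σ j q))
        + (if q = q₀ then if j = i then c else 0 else 0)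
        ≤ mutualInfo h (W' q) (s j • W' (σ j q)) := by
      intro q j
      split_ifs with h1 h2
      · rw [h1, h2]; exact hq₀
      · simpa using hmono q j
      · simpa using hmono q j
    calc _ = ∑ q, ∑ j, (mutualInfo h (W q) (s j • W (σ j q))
        + (if q = q₀ then if j = i then c else 0 else 0)) := by
          simp_rw [Finset.sum_add_distrib]
          congr 1
          rw [Finset.sum_eq_single q₀] <;> simp +contextual
      _ ≤ _ := Finset.sum_le_sum fun q _ => Finset.sum_le_sum fun j _ => this q j
  unfold graphFun
  linarith

end Submodular

/-! ### Balls in the free group -/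

section Balls

variable {r : ℕ}

lemma wlen_mul_le (g h : FG r) : wlen (g * h) ≤ wlen g + wlen h := FreeGroup.norm_mul_le g h

lemma wlen_inv (g : FG r) : wlen g⁻¹ = wlen g := FreeGroup.norm_inv_eq

/-- The ball of radius `n` as a finset. -/
noncomputable def ballF (r n : ℕ) : Finset (FG r) := (Set.toFinite (ball r n)).toFinset

lemma mem_ballF {n : ℕ} {g : FG r} : g ∈ ballF r n ↔ wlen g ≤ n := by
  simp [ballF, ball]

lemma coe_ballF (r n : ℕ) : (ballF r n : Set (FG r)) = ball r n := by
  simp [ballF]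

lemma exists_eq_mul_of_wlen_pos {n : ℕ} {g : FG r} (hg : wlen g = n + 1) :
    ∃ (i : Fin r) (g' : FG r), wlen g' ≤ n ∧
      (g = FreeGroup.of i * g' ∨ g = (FreeGroup.of i)⁻¹ * g') := by
  unfold wlen at hg
  obtain ⟨⟨i, b⟩, l, hl⟩ := List.exists_cons_of_length_eq_add_one hg
  refine ⟨i, FreeGroup.mk l, ?_, ?_⟩
  · refine (FreeGroup.norm_mk_le (L₁ := l)).trans ?_
    rw [hl] at hg
    simpa using hg.le
  · have : g = FreeGroup.mk ((i, b) :: l) := by rw [← hl, FreeGroup.mk_toWord]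
    rw [this]
    cases b
    · right
      simp [FreeGroup.of, FreeGroup.inv_mk, FreeGroup.mul_mk, FreeGroup.invRev]
    · left
      simp [FreeGroup.of, FreeGroup.mul_mk]

end Balls

/-- Families of sets containing `1` and contained in a ball can be enlarged to the whole ball
without increasing `graphFun`. -/
lemma graphFun_ballF_le {r : ℕ} {V : Type*} [Fintype V] {h : Finset (FG r) → ℝ}
    (hh : IsInvSubmodular h) (σ : Fin r → Equiv.Perm V) (W : V → Finset (FG r)) (N : ℕ)
    (hone : ∀ p, 1 ∈ W p) (hW : ∀ p, W p ⊆ ballF r N) :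
    graphFun h FreeGroup.of σ (fun _ => ballF r N) ≤ graphFun h FreeGroup.of σ W := by
  classical
  let Q : Set (V → Finset (FG r)) :=
    {U | U ∈ Set.Icc W (fun _ => ballF r N) ∧
      graphFun h FreeGroup.of σ U ≤ graphFun h FreeGroup.of σ W}
  have hQfin : Q.Finite := (Set.finite_Icc _ _).subset fun U hU => hU.1
  obtain ⟨U, hU⟩ := hQfin.exists_maximal ⟨W, ⟨le_rfl, hW⟩, le_rfl⟩
  have hkey : ∀ n ≤ N, ∀ g : FG r, wlen g ≤ n → ∀ p, g ∈ U p := by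
    intro n
    induction n with
    | zero =>
      intro _ g hg p
      have : g = 1 := FreeGroup.norm_eq_zero.1 (Nat.le_zero.1 hg)
      rw [this]
      exact hU.1.1.1 p (hone p)
    | succ n ih =>
      intro hn g hg p
      rcases Nat.le_succ_iff.1 hg with hg' | hg'
      · exact ih (by omega) g hg' p
      obtain ⟨i, g', hg'n, hgi⟩ := exists_eq_mul_of_wlen_pos hg'
      have hstep : g ∈ FreeGroup.of i • U (σ i p) ∨
          g ∈ (FreeGroup.of i)⁻¹ • U ((σ i).symm p) := by
        rcases hgi with rfl | rfl
        · exact Or.inl (Finset.smul_mem_smul_finset (ih (by omega) g' hg'n _))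
        · exact Or.inr (Finset.smul_mem_smul_finset (ih (by omega) g' hg'n _))
      have hle : U ≤ Function.update U p (insert g (U p)) := by
        rw [le_update_iff]
        exact ⟨Finset.subset_insert _ _, fun _ _ => le_rfl⟩
      have hmem : Function.update U p (insert g (U p)) ∈ Q := by
        refine ⟨⟨hU.1.1.1.trans hle, ?_⟩,
          (graphFun_update_insert_le hh _ σ U p g i hstep).trans hU.1.2⟩
        rw [update_le_iff]
        exact ⟨Finset.insert_subset (mem_ballF.2 (hg.trans hn)) (hU.1.1.2 p),
          fun q _ => hU.1.1.2 q⟩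
      have := hU.2 hmem hle p
      exact this (by simp)
  have : U = fun _ => ballF r N := by
    funext p
    exact Finset.Subset.antisymm (hU.1.1.2 p) fun g hg => hkey N le_rfl g (mem_ballF.1 hg) p
  rw [← this]
  exact hU.1.2

lemma graphFun_const {r : ℕ} {V : Type*} [Fintype V] {h : Finset (FG r) → ℝ}
    (hh : IsInvSubmodular h) (σ : Fin r → Equiv.Perm V) (A : Finset (FG r)) :
    graphFun h FreeGroup.of σ (fun _ => A) = Fintype.card V *
      ((1 - 2 * (r : ℝ)) * h A + ∑ i : Fin r, h (FreeGroup.of i • A ∪ A)) := by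
  simp only [graphFun, mutualInfo, hh.smul, Finset.sum_const, Finset.card_univ, nsmul_eq_mul,
    Finset.sum_sub_distrib, Fintype.card_fin, Finset.union_comm A]
  ring

/-- A cyclically reduced word, read around a cycle, extends to a permutation representation. -/
lemma exists_perm_of_cyclic {n : ℕ} {ι : Type*} (x : Fin (n + 1) → ι × Bool)
    (hx : ∀ i, (x i).1 = (x (i + 1)).1 → (x i).2 = (x (i + 1)).2) :
    ∃ σ : ι → Equiv.Perm (Fin (n + 1)), ∀ i,
      ((x i).2 = true → σ (x i).1 i = i + 1) ∧
      ((x i).2 = false → σ (x i).1 (i + 1) = i) := by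
  classical
  suffices H : ∀ s : ι, ∃ τ : Equiv.Perm (Fin (n + 1)), ∀ i, (x i).1 = s →
      ((x i).2 = true → τ i = i + 1) ∧ ((x i).2 = false → τ (i + 1) = i) by
    choose σ hσ using H
    exact ⟨σ, fun i => hσ _ i rfl⟩
  intro s
  let f : Fin (n + 1) → Fin (n + 1) := fun i => if x i = (s, true) then i + 1 else i - 1
  let D : Set (Fin (n + 1)) := {i | x i = (s, true) ∨ x (i - 1) = (s, false)}
  have hinj : Set.InjOn f D := by
    intro i hi j hj hij
    have h1 := hx i
    have h2 := hx j
    simp only [f] at hij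
    split_ifs at hij with hxi hxj hxj
    · exact add_right_cancel hij
    · have hj' : x (j - 1) = (s, false) := hj.resolve_left hxj
      rw [← hij] at hj'
      simp [hxi, hj'] at h1
    · have hi' : x (i - 1) = (s, false) := hi.resolve_left hxi
      rw [hij] at hi'
      simp [hxj, hi'] at h2
    · exact sub_left_injective hij
  obtain ⟨g, hg⟩ := Set.MapsTo.exists_equiv_extend_of_card_eq (α := Fin (n + 1))
    (t := Finset.univ) (by simp) (s := D) (f := f) (fun i _ => by simp) hinj
  refine ⟨g.trans (Equiv.subtypeUnivEquiv (by simp)), fun i his => ⟨fun hi => ?_, fun hi => ?_⟩⟩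
  · have hxi : x i = (s, true) := Prod.ext his hi
    have := hg i (Or.inl hxi)
    simpa [f, hxi] using this
  · have hxi : x i = (s, false) := Prod.ext his hi
    have hne : x (i + 1) ≠ (s, true) := by
      intro hxi'
      have := hx i
      simp [hxi, hxi'] at this
    have := hg (i + 1) (Or.inr (by simpa using hxi))
    simpa [f, hne] using this

/-- A nontrivial normal subgroup of a free group contains a nontrivial element with cyclically
reduced word. -/
lemma exists_isCyclicallyReduced_mem {r : ℕ} (K : Subgroup (FG r)) (hK : K.Normal)
    (hKnt : K ≠ ⊥) :
    ∃ L : List (Fin r × Bool), L ≠ [] ∧ FreeGroup.IsCyclicallyReduced L ∧ FreeGroup.mk L ∈ K := by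
  obtain ⟨k, hk, hk1⟩ := (Subgroup.ne_bot_iff_exists_ne_one.1 hKnt).elim
    fun a ha => (⟨a.1, a.2, fun h => ha (Subtype.ext h)⟩ : ∃ k : FG r, k ∈ K ∧ k ≠ 1)
  have hconj : k = FreeGroup.mk (FreeGroup.reduceCyclically.conjugator k.toWord)
      * FreeGroup.mk (FreeGroup.reduceCyclically k.toWord)
      * (FreeGroup.mk (FreeGroup.reduceCyclically.conjugator k.toWord))⁻¹ := by
    rw [FreeGroup.inv_mk, FreeGroup.mul_mk, FreeGroup.mul_mk,
      FreeGroup.reduceCyclically.conj_conjugator_reduceCyclically, FreeGroup.mk_toWord]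
  set c := FreeGroup.mk (FreeGroup.reduceCyclically.conjugator k.toWord)
  refine ⟨FreeGroup.reduceCyclically k.toWord, ?_,
    FreeGroup.reduceCyclically.isCyclicallyReduced FreeGroup.isReduced_toWord, ?_⟩
  · intro h
    rw [h] at hconj
    apply hk1
    rw [hconj, ← FreeGroup.one_eq_mk]
    simp
  · have := hK.conj_mem k hk c⁻¹
    rw [hconj] at this
    simpa [mul_assoc] using this

/-- A nontrivial normal subgroup `K` yields a finite permutation representation of the free group
with vertex labels for which at least as many edges as vertices are trivial modulo `K`. -/
lemma exists_perm_card_le {r : ℕ} (K : Subgroup (FG r)) (hK : K.Normal) (hKnt : K ≠ ⊥) :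
    ∃ (n : ℕ) (σ : Fin r → Equiv.Perm (Fin (n + 1))) (t : Fin (n + 1) → FG r)
      (E : Finset (Fin (n + 1) × Fin r)), n + 1 ≤ E.card ∧
      ∀ e ∈ E, t e.1 * FreeGroup.of e.2 * (t (σ e.2 e.1))⁻¹ ∈ K := by
  classical
  obtain ⟨L, hL, hred, hmem⟩ := exists_isCyclicallyReduced_mem K hK hKnt
  obtain ⟨n, hn⟩ : ∃ n, L.length = n + 1 :=
    Nat.exists_eq_succ_of_ne_zero (by simpa using hL)
  let x : Fin (n + 1) → Fin r × Bool := fun i => L[(i : ℕ)]'(by omega)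
  have hx : ∀ i, (x i).1 = (x (i + 1)).1 → (x i).2 = (x (i + 1)).2 := by
    intro i
    rcases eq_or_ne i (Fin.last n) with rfl | hi
    · refine hred.2 _ ?_ _ ?_
      · simp [x, List.getLast?_eq_getElem?, hn]
      · simp [x, List.head?_eq_getElem?, hn]
    · have hlt : (i : ℕ) < n := Fin.val_lt_last hi
      have hval : ((i + 1 : Fin (n + 1)) : ℕ) = i + 1 := Fin.val_add_one_of_lt
        (Fin.lt_last_iff_ne_last.2 hi)
      have := List.isChain_iff_getElem.1 hred.1 i (by omega)
      simpa only [x, hval] using this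
  obtain ⟨σ, hσ⟩ := exists_perm_of_cyclic x hx
  let t : Fin (n + 1) → FG r := fun i => FreeGroup.mk (L.take i)
  have hstep : ∀ i, t i * FreeGroup.mk [x i] * (t (i + 1))⁻¹ ∈ K := by
    intro i
    have hmul : t i * FreeGroup.mk [x i] = FreeGroup.mk (L.take (i + 1)) := by
      simp only [t, FreeGroup.mul_mk, x]
      rw [List.take_concat_get' L i (by omega)]
    rw [hmul]
    rcases eq_or_ne i (Fin.last n) with rfl | hi
    · have : t (Fin.last n + 1) = 1 := by simp [t, FreeGroup.one_eq_mk]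
      rw [this]
      simpa [← hn] using hmem
    · have hval : ((i + 1 : Fin (n + 1)) : ℕ) = i + 1 := Fin.val_add_one_of_lt
        (Fin.lt_last_iff_ne_last.2 hi)
      simp only [t, hval, mul_inv_cancel, K.one_mem]
  let edge : Fin (n + 1) → Fin (n + 1) × Fin r := fun i =>
    if (x i).2 then (i, (x i).1) else (i + 1, (x i).1)
  have hedge : Function.Injective edge := by
    intro i j hij
    have h1 := hx i
    have h2 := hx j
    simp only [edge] at hij
    split_ifs at hij with hi hj hj <;> simp only [Prod.mk.injEq] at hij
    · exact hij.1
    · obtain ⟨rfl, hij⟩ := hij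
      simp_all
    · obtain ⟨rfl, hij⟩ := hij
      simp_all
    · exact add_right_cancel hij.1
  refine ⟨n, σ, t, Finset.univ.image edge, ?_, ?_⟩
  · rw [Finset.card_image_of_injective _ hedge]
    simp
  · intro e he
    obtain ⟨i, -, rfl⟩ := Finset.mem_image.1 he
    have hi := hstep i
    rcases hb : (x i).2 with _ | _
    · have hxi : FreeGroup.mk [x i] = (FreeGroup.of (x i).1)⁻¹ := by
        have : x i = ((x i).1, false) := Prod.ext rfl hb
        rw [this]
        simp [FreeGroup.of, FreeGroup.inv_mk, FreeGroup.invRev]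
      have := K.inv_mem hi
      simp only [edge, hb, Bool.false_eq_true, if_false, (hσ i).2 hb]
      rw [hxi] at this
      simpa [mul_assoc] using this
    · have hxi : FreeGroup.mk [x i] = FreeGroup.of (x i).1 := by
        have : x i = ((x i).1, true) := Prod.ext rfl hb
        rw [this]
        simp [FreeGroup.of]
      simp only [edge, hb, if_true, (hσ i).1 hb]
      rwa [hxi] at hi

/-- The functional `F` is unbounded below along balls for an unbounded invariant submodular
function which is trivial in the direction of a nontrivial normal subgroup. -/
lemma exists_ballF_functional_le {r : ℕ} (hr : 1 < r) (K : Subgroup (FG r)) (hK : K.Normal)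
    (hKnt : K ≠ ⊥) {h : Finset (FG r) → ℝ} (hh : IsInvSubmodular h)
    (hinv : ∀ k ∈ K, ∀ A : Finset (FG r), h (A ∪ k • A) = h A)
    (hunb : ∀ C : ℝ, ∃ m, C ≤ h (ballF r m)) (C : ℝ) :
    ∃ N, (1 - 2 * (r : ℝ)) * h (ballF r N)
      + ∑ i : Fin r, h (FreeGroup.of i • ballF r N ∪ ballF r N) ≤ C := by
  classical
  obtain ⟨n, σ, t, E, hE, hEK⟩ := exists_perm_card_le K hK hKnt
  obtain ⟨l, hl⟩ : ∃ l, ∀ p, wlen (t p) ≤ l :=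
    ⟨Finset.univ.sup fun p => wlen (t p),
      fun p => Finset.le_sup (f := fun p => wlen (t p)) (Finset.mem_univ p)⟩
  obtain ⟨m, hm⟩ := hunb (max 0 (-((n + 1 : ℝ) * C)))
  have hm0 : 0 ≤ h (ballF r m) := (le_max_left _ _).trans hm
  have hmC : -((n + 1 : ℝ) * C) ≤ h (ballF r m) := (le_max_right _ _).trans hm
  set M := m + (2 * l + 1) with hM
  have hmM : h (ballF r m) ≤ h (ballF r M) :=
    hh.mono _ _ fun g hg => mem_ballF.2 ((mem_ballF.1 hg).trans (by omega))
  let W : Fin (n + 1) → Finset (FG r) := fun p => (t p)⁻¹ • ballF r M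
  have hWmem : ∀ p g, g ∈ W p ↔ wlen (t p * g) ≤ M := by
    intro p g
    simp only [W]
    rw [Finset.mem_inv_smul_finset_iff, mem_ballF, smul_eq_mul]
  have hone : ∀ p, 1 ∈ W p := by
    intro p
    rw [hWmem, mul_one]
    exact (hl p).trans (by omega)
  have hWN : ∀ p, W p ⊆ ballF r (M + l) := by
    intro p g hg
    rw [hWmem] at hg
    have h1 := wlen_mul_le (t p)⁻¹ (t p * g)
    rw [inv_mul_cancel_left, wlen_inv] at h1
    have := hl p
    exact mem_ballF.2 (by omega)
  have hedge : ∀ p i, mutualInfo h (W p) (FreeGroup.of i • W (σ i p)) = mutualInfo h (ballF r M)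
      ((t p * FreeGroup.of i * (t (σ i p))⁻¹) • ballF r M) := by
    intro p i
    rw [← hh.mutualInfo_smul (t p)]
    simp only [W]
    rw [smul_inv_smul, smul_smul, smul_smul]
  have hgood : ∀ e ∈ E,
      h (ballF r M) ≤ mutualInfo h (W e.1) (FreeGroup.of e.2 • W (σ e.2 e.1)) := by
    intro e he
    rw [hedge, mutualInfo, hinv _ (hEK e he), hh.smul]
    linarith
  have hall : ∀ e : Fin (n + 1) × Fin r,
      h (ballF r m) ≤ mutualInfo h (W e.1) (FreeGroup.of e.2 • W (σ e.2 e.1)) := by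
    intro e
    rw [hedge]
    refine hh.le_mutualInfo ?_ ?_
    · exact fun g hg => mem_ballF.2 ((mem_ballF.1 hg).trans (by omega))
    · intro g hg
      rw [← Finset.inv_smul_mem_iff, mem_ballF, smul_eq_mul]
      have h1 := wlen_mul_le (t e.1 * FreeGroup.of e.2 * (t (σ e.2 e.1))⁻¹)⁻¹ g
      rw [wlen_inv] at h1
      have h2 := wlen_mul_le (t e.1 * FreeGroup.of e.2) (t (σ e.2 e.1))⁻¹
      have h3 := wlen_mul_le (t e.1) (FreeGroup.of e.2)
      have h4 : wlen (FreeGroup.of e.2) = 1 := FreeGroup.norm_of _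
      rw [wlen_inv] at h2
      have := hl e.1
      have := hl (σ e.2 e.1)
      have := mem_ballF.1 hg
      omega
  have hsum : (n + 1 : ℝ) * h (ballF r M) + h (ballF r m)
      ≤ ∑ p, ∑ i, mutualInfo h (W p) (FreeGroup.of i • W (σ i p)) := by
    rw [← Fintype.sum_prod_type', ← Finset.sum_add_sum_compl E]
    have h1 := Finset.card_nsmul_le_sum E _ _ hgood
    have h2 := Finset.card_nsmul_le_sum Eᶜ _ _ fun e _ => hall e
    rw [nsmul_eq_mul] at h1 h2
    have hcard : (E.card : ℝ) + (Eᶜ.card : ℝ) = (n + 1) * r := by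
      have := Finset.card_add_card_compl E
      rw [Fintype.card_prod, Fintype.card_fin, Fintype.card_fin] at this
      exact_mod_cast this
    have hE' : (n + 1 : ℝ) ≤ E.card := by exact_mod_cast hE
    have hr' : (2 : ℝ) ≤ r := by exact_mod_cast hr
    have hn0 : (0 : ℝ) ≤ n := n.cast_nonneg
    nlinarith [mul_nonneg (sub_nonneg.2 hE') (sub_nonneg.2 hmM),
      mul_nonneg (mul_nonneg hn0 (by linarith : (0 : ℝ) ≤ r - 1)) hm0,
      mul_nonneg (by linarith : (0 : ℝ) ≤ r - 2) hm0]
  have hinit : graphFun h FreeGroup.of σ W ≤ -h (ballF r m) := by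
    unfold graphFun
    have : ∀ p, h (W p) = h (ballF r M) := fun p => hh.smul _ _
    simp only [this, Finset.sum_const, Finset.card_univ, Fintype.card_fin, nsmul_eq_mul]
    push_cast
    linarith
  have hfin := (graphFun_ballF_le hh σ W (M + l) hone hWN).trans hinit
  rw [graphFun_const hh, Fintype.card_fin] at hfin
  refine ⟨M + l, ?_⟩
  have hpos : (0 : ℝ) < n + 1 := by positivity
  push_cast at hfin
  exact le_of_mul_le_mul_left (by linarith) hpos

/-! ### Entropy of the joins of the translates of a partition -/

section Join

variable {G X : Type*} [Group G] [MeasurableSpace X] {μ : Measure X}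

namespace BorelAction

lemma joinF_eq_iff {I : Type*} (T : BorelAction G X) (F : Set G) (a : X → I) (x y : X) :
    T.joinF F a x = T.joinF F a y ↔ ∀ f ∈ F, a (T.act f⁻¹ x) = a (T.act f⁻¹ y) := by
  simp [joinF, funext_iff]

lemma measurable_joinF {I : Type*} [MeasurableSpace I] (T : BorelAction G X) (F : Set G)
    {a : X → I} (ha : Measurable a) : Measurable (T.joinF F a) :=
  measurable_pi_lambda _ fun _ => ha.comp (T.measurable_act _)

end BorelAction

lemma Hpart_comp_measurePreserving {I : Type*} [Countable I] [MeasurableSpace I]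
    [MeasurableSingletonClass I] {b : X → I} (hb : Measurable b) {t : X → X}
    (ht : MeasurePreserving t μ μ) : Hpart μ (fun x => b (t x)) = Hpart μ b := by
  refine tsum_congr fun i => ?_
  rw [← ht.measure_preimage (hb (measurableSet_singleton i)).nullMeasurableSet]
  rfl

/-- The entropy of the join of the translates of `a` over a finite set. -/
noncomputable def joinEntropy (μ : Measure X) (T : BorelAction G X) (a : X → ℕ)
    (F : Finset G) : ℝ :=
  (Hpart μ (T.joinF (F : Set G) a)).toReal

variable [IsProbabilityMeasure μ] {T : BorelAction G X} {a : X → ℕ}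

lemma Hpart_joinF_mono (ha : Measurable a) {E F : Set G} [Finite E] [Finite F] (hEF : E ⊆ F) :
    Hpart μ (T.joinF E a) ≤ Hpart μ (T.joinF F a) :=
  Hpart_mono (T.measurable_joinF E ha) (T.measurable_joinF F ha) fun x y hxy => by
    rw [T.joinF_eq_iff] at hxy ⊢
    exact fun f hf => hxy f (hEF hf)

lemma Hpart_joinF_submodular [DecidableEq G] (ha : Measurable a) (E F : Finset G) :
    Hpart μ (T.joinF ((E ∪ F : Finset G) : Set G) a)
        + Hpart μ (T.joinF ((E ∩ F : Finset G) : Set G) a)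
      ≤ Hpart μ (T.joinF (E : Set G) a) + Hpart μ (T.joinF (F : Set G) a) := by
  have hE := T.measurable_joinF (E : Set G) ha
  have hF := T.measurable_joinF (F : Set G) ha
  have hI := T.measurable_joinF ((E ∩ F : Finset G) : Set G) ha
  have hU := T.measurable_joinF ((E ∪ F : Finset G) : Set G) ha
  convert Hpart_submodular (μ := μ) hE hF hI using 2
  · refine Hpart_congr hU (hE.prodMk (hF.prodMk hI)) fun x y => ?_
    simp only [Prod.mk.injEq, T.joinF_eq_iff, Finset.mem_coe, Finset.mem_union, Finset.mem_inter]
    grind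
  · refine Hpart_congr hE (hE.prodMk hI) fun x y => ?_
    simp only [Prod.mk.injEq, T.joinF_eq_iff, Finset.mem_coe, Finset.mem_inter]
    grind
  · refine Hpart_congr hF (hF.prodMk hI) fun x y => ?_
    simp only [Prod.mk.injEq, T.joinF_eq_iff, Finset.mem_coe, Finset.mem_inter]
    grind

lemma Hpart_joinF_smul [DecidableEq G] (hT : T.Preserves μ) (ha : Measurable a) (g : G)
    (F : Finset G) :
    Hpart μ (T.joinF ((g • F : Finset G) : Set G) a) = Hpart μ (T.joinF (F : Set G) a) := by
  have hF := T.measurable_joinF (F : Set G) ha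
  rw [← Hpart_comp_measurePreserving hF (hT g⁻¹)]
  refine Hpart_congr (T.measurable_joinF _ ha) (hF.comp (T.measurable_act _)) fun x y => ?_
  simp only [T.joinF_eq_iff, Finset.mem_coe, Finset.mem_smul_finset, smul_eq_mul,
    forall_exists_index, and_imp, forall_apply_eq_imp_iff₂, mul_inv_rev, T.act_mul]

lemma Hpart_joinF_ne_top [DecidableEq G] (hT : T.Preserves μ) (ha : Measurable a)
    (hfin : Hpart μ a < ⊤) (F : Finset G) : Hpart μ (T.joinF (F : Set G) a) ≠ ⊤ := by
  induction F using Finset.induction_on with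
  | empty =>
    refine ((Hpart_mono (T.measurable_joinF _ ha) ha fun x y _ => ?_).trans_lt hfin).ne
    simp [T.joinF_eq_iff]
  | insert g F _ ih =>
    have hsing : Hpart μ (T.joinF (({g} : Finset G) : Set G) a) = Hpart μ a := by
      rw [← Hpart_comp_measurePreserving ha (hT g⁻¹)]
      refine Hpart_congr (T.measurable_joinF _ ha) (ha.comp (T.measurable_act _)) fun x y => ?_
      simp [T.joinF_eq_iff]
    have := Hpart_joinF_submodular (μ := μ) (T := T) ha {g} F
    rw [hsing, ← Finset.insert_eq] at this
    exact ((le_self_add.trans this).trans_lt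
      (ENNReal.add_lt_top.2 ⟨hfin, ih.lt_top⟩)).ne

lemma isInvSubmodular_joinEntropy [DecidableEq G] (hT : T.Preserves μ) (ha : Measurable a)
    (hfin : Hpart μ a < ⊤) : IsInvSubmodular (joinEntropy μ T a) where
  mono A B hAB := ENNReal.toReal_mono (Hpart_joinF_ne_top hT ha hfin B)
    (Hpart_joinF_mono ha (Finset.coe_subset.2 hAB))
  submod A B := by
    have hne := Hpart_joinF_ne_top hT ha hfin
    unfold joinEntropy
    rw [← ENNReal.toReal_add (hne _) (hne _), ← ENNReal.toReal_add (hne _) (hne _)]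
    exact ENNReal.toReal_mono (ENNReal.add_ne_top.2 ⟨hne _, hne _⟩)
      (Hpart_joinF_submodular ha A B)
  smul g A := congrArg ENNReal.toReal (Hpart_joinF_smul hT ha g A)

lemma joinEntropy_union_smul_of_act_eq [DecidableEq G] (ha : Measurable a) {k : G}
    (hk : ∀ x, T.act k x = x) (A : Finset G) :
    joinEntropy μ T a (A ∪ k • A) = joinEntropy μ T a A := by
  have hk' : ∀ x, T.act k⁻¹ x = x := fun x => by
    conv_lhs => rw [← hk x]
    rw [← T.act_mul, inv_mul_cancel, T.act_one]
  refine congrArg ENNReal.toReal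
    (Hpart_congr (T.measurable_joinF _ ha) (T.measurable_joinF _ ha) fun x y => ?_)
  simp only [T.joinF_eq_iff, Finset.mem_coe, Finset.mem_union, Finset.mem_smul_finset,
    smul_eq_mul]
  refine ⟨fun h f hf => h f (Or.inl hf), fun h f hf => ?_⟩
  rcases hf with hf | ⟨f', hf', rfl⟩
  · exact h f hf
  · simpa only [mul_inv_rev, T.act_mul, hk'] using h f' hf'

end Join

lemma fSeq_eq_joinEntropy {r : ℕ} {X : Type*} [MeasurableSpace X] {μ : Measure X}
    [IsProbabilityMeasure μ] (T : BorelAction (FG r) X) {a : X → ℕ} (ha : Measurable a) (n : ℕ) :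
    fSeq μ T a n = (1 - 2 * (r : ℝ)) * joinEntropy μ T a (ballF r n)
      + ∑ i : Fin r, joinEntropy μ T a (FreeGroup.of i • ballF r n ∪ ballF r n) := by
  have hb := T.measurable_joinF (ball r n) ha
  unfold fSeq FF joinEntropy
  congr 2
  · exact congrArg ENNReal.toReal
      (Hpart_congr hb (T.measurable_joinF _ ha) fun x y => by
        simp only [T.joinF_eq_iff, coe_ballF])
  · refine funext fun i => congrArg ENNReal.toReal
      (Hpart_congr ((hb.comp (T.measurable_act _)).prodMk hb) (T.measurable_joinF _ ha)
        fun x y => ?_)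
    simp only [Prod.mk.injEq, BorelAction.tr, T.joinF_eq_iff, Finset.coe_union,
      Finset.coe_smul_finset, coe_ballF, Set.mem_union, Set.mem_smul_set, smul_eq_mul, or_imp,
      forall_and, forall_exists_index, and_imp, forall_apply_eq_imp_iff₂, mul_inv_rev, T.act_mul]

/-! ### Boundedness of the entropies forces pure atomicity -/

section Atomic

variable {G X : Type*} [Group G] [MeasurableSpace X] {μ : Measure X}

/-- If every Borel set is null or conull in a set `E` of positive measure, then `E` is a point
up to a null set. -/
lemma exists_measure_inter_compl_singleton_eq_zero [StandardBorelSpace X] [IsFiniteMeasure μ]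
    {E : Set X} (hE : MeasurableSet E) (hpos : μ E ≠ 0)
    (hzo : ∀ B, MeasurableSet B → μ (E ∩ B) = 0 ∨ μ (E ∩ Bᶜ) = 0) :
    ∃ x, μ (E ∩ {x}ᶜ) = 0 := by
  have hprob := ProbabilityTheory.cond_isProbabilityMeasure (μ := μ) hpos
  have hcond : ∀ B, μ (E ∩ B) = 0 → ProbabilityTheory.cond μ E B = 0 := fun B hB => by
    rw [ProbabilityTheory.cond_apply hE, hB, mul_zero]
  have : IsZeroOneMeasure (ProbabilityTheory.cond μ E) := ⟨fun B hB => by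
    rcases hzo B hB with h | h
    · exact Or.inl (hcond B h)
    · exact Or.inr ((prob_compl_eq_zero_iff hB).1 (hcond _ h))⟩
  obtain ⟨x, hx⟩ := IsZeroOneMeasure.exists_eq_dirac (μ := ProbabilityTheory.cond μ E)
  refine ⟨x, ?_⟩
  have h0 : ProbabilityTheory.cond μ E {x}ᶜ = 0 := by
    rw [hx]
    simp
  rw [ProbabilityTheory.cond_apply hE] at h0
  exact (mul_eq_zero.1 h0).resolve_left (ENNReal.inv_ne_zero.2 (measure_ne_top _ _))

lemma exists_preimage_joinF_of_measurableSet_partSA {I : Type*} (T : BorelAction G X) {a : X → I}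
    {B : Set X} (hB : MeasurableSet[T.partSA Set.univ a] B) :
    ∃ C, T.joinF Set.univ a ⁻¹' C = B := by
  have hle : T.partSA Set.univ a ≤ MeasurableSpace.comap (T.joinF Set.univ a) ⊤ := by
    refine iSup₂_le fun f hf => ?_
    rintro _ ⟨C, -, rfl⟩
    exact ⟨{z | z ⟨f, hf⟩ ∈ C}, trivial, rfl⟩
  obtain ⟨C, -, hC⟩ := hle B hB
  exact ⟨C, hC⟩

lemma exists_fiber_inter_compl_singleton_eq_zero [Countable G] [StandardBorelSpace X]
    [IsFiniteMeasure μ] {T : BorelAction G X} {a : X → ℕ} (ha : Measurable a)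
    (hgen : T.Generating a μ) {z : ↥(Set.univ : Set G) → ℕ}
    (hz : μ (T.joinF Set.univ a ⁻¹' {z}) ≠ 0) :
    ∃ x, μ (T.joinF Set.univ a ⁻¹' {z} ∩ {x}ᶜ) = 0 := by
  refine exists_measure_inter_compl_singleton_eq_zero
    (T.measurable_joinF _ ha (measurableSet_singleton z)) hz fun B hB => ?_
  obtain ⟨B', hB', h0⟩ := hgen B hB
  obtain ⟨C, rfl⟩ := exists_preimage_joinF_of_measurableSet_partSA T hB'
  by_cases hzC : z ∈ C
  · right
    refine measure_mono_null (fun x hx => Or.inr ⟨?_, hx.2⟩) h0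
    rw [Set.mem_preimage, (hx.1 : T.joinF Set.univ a x = z)]
    exact hzC
  · left
    refine measure_mono_null (fun x hx => Or.inl ⟨hx.2, fun h => hzC ?_⟩) h0
    rw [← (hx.1 : T.joinF Set.univ a x = z)]
    exact h

lemma purelyAtomic_of_ae_fiber_pos [Countable G] [StandardBorelSpace X]
    [IsProbabilityMeasure μ] {T : BorelAction G X} {a : X → ℕ} (ha : Measurable a)
    (hgen : T.Generating a μ)
    (hpos : ∀ᵐ x ∂μ, 0 < μ (T.joinF Set.univ a ⁻¹' {T.joinF Set.univ a x})) :
    PurelyAtomic μ := by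
  have hcount := Measure.countable_meas_pos_of_disjoint_iUnion (μ := μ)
    (As := fun z => T.joinF Set.univ a ⁻¹' {z})
    (fun z => T.measurable_joinF _ ha (measurableSet_singleton z))
    (fun z w hzw => Set.disjoint_left.2 fun x hx hx' => hzw (hx.symm.trans hx'))
  have hfiber : ∀ z ∈ {z | 0 < μ (T.joinF Set.univ a ⁻¹' {z})},
      ∀ᵐ x ∂μ, T.joinF Set.univ a x = z → 0 < μ {x} := by
    intro z hz
    obtain ⟨x₀, hx₀⟩ := exists_fiber_inter_compl_singleton_eq_zero ha hgen
      (pos_iff_ne_zero.1 hz)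
    have hx₀pos : 0 < μ {x₀} := by
      refine lt_of_lt_of_le hz ?_
      calc μ (T.joinF Set.univ a ⁻¹' {z})
          ≤ μ (T.joinF Set.univ a ⁻¹' {z} ∩ {x₀}ᶜ ∪ {x₀}) := measure_mono fun x hx => by
            by_cases h : x = x₀
            · exact Or.inr h
            · exact Or.inl ⟨hx, h⟩
        _ ≤ _ := (measure_union_le _ _).trans (by rw [hx₀, zero_add])
    filter_upwards [measure_eq_zero_iff_ae_notMem.1 hx₀] with x hx hxz
    have : x = x₀ := by
      by_contra h
      exact hx ⟨hxz, h⟩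
    rwa [this]
  have hae : ∀ᵐ x ∂μ, 0 < μ {x} := by
    filter_upwards [hpos, (ae_ball_iff hcount).2 hfiber] with x hx hx'
    exact hx' _ hx rfl
  have : {x | 0 < μ {x}} =ᵐ[μ] Set.univ := eventuallyEq_univ.2 hae
  rw [PurelyAtomic, measure_congr this, measure_univ]

lemma ball_mono {r m n : ℕ} (hmn : m ≤ n) : ball r m ⊆ ball r n :=
  fun _ hg => le_trans hg hmn

lemma ae_fiber_pos_of_Hpart_joinF_ball_le {r : ℕ} [IsProbabilityMeasure μ]
    {T : BorelAction (FG r) X} {a : X → ℕ} (ha : Measurable a) {C : ℝ≥0∞} (hC : C ≠ ⊤)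
    (hle : ∀ n, Hpart μ (T.joinF (ball r n) a) ≤ C) :
    ∀ᵐ x ∂μ, 0 < μ (T.joinF Set.univ a ⁻¹' {T.joinF Set.univ a x}) := by
  let b := fun n => T.joinF (ball r n) a
  have hb : ∀ n, Measurable (b n) := fun n => T.measurable_joinF _ ha
  let J := fun n x => ENNReal.ofReal (-Real.log (μ (b n ⁻¹' {b n x})).toReal)
  have hJ : ∀ n, Measurable (J n) := fun n => measurable_ofReal_neg_log_measure_fiber (hb n)
  have hint : ∫⁻ x, liminf (fun n => J n x) atTop ∂μ ≠ ⊤ := by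
    refine ((lintegral_liminf_le hJ).trans ?_).trans_lt hC.lt_top |>.ne
    refine liminf_le_of_le (by isBoundedDefault) fun c hc => ?_
    obtain ⟨n, hn⟩ := hc.exists
    refine hn.trans ?_
    rw [← Hpart_eq_lintegral (hb n)]
    exact hle n
  filter_upwards [ae_lt_top (.liminf hJ) hint,
    ae_all_iff.2 fun n => ae_measure_fiber_pos (μ := μ) (hb n)] with x hx hpos
  have hcell : T.joinF Set.univ a ⁻¹' {T.joinF Set.univ a x} = ⋂ n, b n ⁻¹' {b n x} := by
    ext y
    simp only [Set.mem_preimage, Set.mem_singleton_iff, Set.mem_iInter, b, T.joinF_eq_iff]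
    exact ⟨fun h n f _ => h f trivial, fun h f _ => h (wlen f) f (le_refl (wlen f))⟩
  have hanti : Antitone fun n => b n ⁻¹' {b n x} := fun m n hmn y hy => by
    simp only [Set.mem_preimage, Set.mem_singleton_iff, b, T.joinF_eq_iff] at hy ⊢
    exact fun f hf => hy f (ball_mono hmn hf)
  have hlim := tendsto_measure_iInter_atTop (μ := μ)
    (fun n => (hb n (measurableSet_singleton (b n x))).nullMeasurableSet) hanti
    ⟨0, measure_ne_top _ _⟩
  rw [hcell]
  obtain ⟨c, hc, hc'⟩ := exists_between hx
  have hfreq := frequently_lt_of_liminf_lt (by isBoundedDefault) hc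
  refine lt_of_lt_of_le (ENNReal.ofReal_pos.2 (Real.exp_pos (-c.toReal)))
    (ge_of_tendsto_of_frequently hlim (hfreq.mono fun n hn => ?_))
  have h1 : -Real.log (μ (b n ⁻¹' {b n x})).toReal ≤ c.toReal :=
    (ENNReal.ofReal_le_iff_le_toReal hc'.ne).1 hn.le
  have h2 := ENNReal.toReal_pos (hpos n).ne' (measure_ne_top _ _)
  refine ENNReal.ofReal_le_of_le_toReal ?_
  rw [Function.comp_apply, ← Real.le_log_iff_exp_le h2]
  linarith

end Atomic

/-- Actions factoring through a proper quotient of `G` have f-invariant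
entropy `−∞` (when defined and `μ` is not purely atomic). -/
theorem statement10 {r : ℕ} (hr : 1 < r) {X : Type*}
    [mX : MeasurableSpace X] [StandardBorelSpace X]
    (μ : Measure X) [IsProbabilityMeasure μ]
    (T : BorelAction (FG r) X) (hT : T.Preserves μ)
    (K : Subgroup (FG r)) (hK : K.Normal) (hKnt : K ≠ ⊥)
    (hfac : ∀ k ∈ K, ∀ x : X, T.act k x = x)
    (hdef : ∃ a : X → ℕ, Measurable a ∧ T.Generating a μ ∧ Hpart μ a < ⊤)
    (hatom : ¬ PurelyAtomic μ) :
    ∀ a : X → ℕ, Measurable a → T.Generating a μ → Hpart μ a < ⊤ →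
      fInv μ T a = ⊥ := by
  intro a ha hgen hfin
  have hunb : ∀ C : ℝ, ∃ m, C ≤ joinEntropy μ T a (ballF r m) := by
    intro C
    by_contra! hlt
    refine hatom (purelyAtomic_of_ae_fiber_pos ha hgen
      (ae_fiber_pos_of_Hpart_joinF_ball_le ha (C := ENNReal.ofReal C) ENNReal.ofReal_ne_top
        fun n => ?_))
    have hle := (hlt n).le
    refine (Hpart_joinF_mono ha (coe_ballF r n).ge).trans ?_
    exact ENNReal.le_ofReal_iff_toReal_le (Hpart_joinF_ne_top hT ha hfin _)
      (ENNReal.toReal_nonneg.trans hle) |>.2 hle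
  rw [fInv, EReal.eq_bot_iff_forall_lt]
  intro C
  obtain ⟨N, hN⟩ := exists_ballF_functional_le hr K hK hKnt
    (isInvSubmodular_joinEntropy hT ha hfin)
    (fun k hk => joinEntropy_union_smul_of_act_eq ha (hfac k hk)) hunb (C - 1)
  rw [← fSeq_eq_joinEntropy T ha] at hN
  refine (iInf_le _ N).trans_lt (EReal.coe_lt_coe_iff.2 ?_)
  linarith

end FPaper
end
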